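/- Let O ⊆ ℝ^d be an open set and let δ, ω be positive Borel measures on O with compact support in O such that ω is an sbh(O)-balayage of δ. Set S := supp ω ∪ supp δ and S_O := infill_O S. Then ∫ u dδ ≤ ∫ u dω for every function u subharmonic on an open neighborhood of S_O; in particular, for every open set O′ ⊆ ℝ^d with O′ ⊇ S_O, ω is an sbh(O′)-balayage of δ. -/

import Mathlib

open MeasureTheory Metric Set Filter
open scoped ENNReal Topology OnePoint

noncomputable section

/-- `d`-dimensional Euclidean space. -/
abbrev Euc (d : ℕ) : Type := EuclideanSpace ℝ (Fin d)

/-- A real-valued function is *harmonic on a set* if it is continuous there and satisfies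
the mean value equality over every closed ball contained in the set. -/
def HarmOn {d : ℕ} (h : Euc d → ℝ) (O : Set (Euc d)) : Prop :=
  ContinuousOn h O ∧
    ∀ x : Euc d, ∀ r : ℝ, 0 < r → closedBall x r ⊆ O →
      h x = ⨍ y in closedBall x r, h y ∂volume

/-- An `EReal`-valued function is *subharmonic on a set* if it is upper semicontinuous there,
nowhere `+∞` there, and on every closed ball contained in the set it is dominated by each
continuous function harmonic in the interior that dominates it on the boundary sphere. -/
def SbhOn {d : ℕ} (u : Euc d → EReal) (O : Set (Euc d)) : Prop :=
  UpperSemicontinuousOn u O ∧ (∀ x ∈ O, u x < ⊤) ∧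
    ∀ x : Euc d, ∀ r : ℝ, 0 < r → closedBall x r ⊆ O →
      ∀ h : Euc d → ℝ, ContinuousOn h (closedBall x r) → HarmOn h (ball x r) →
        (∀ y ∈ sphere x r, u y ≤ (h y : EReal)) →
        ∀ y ∈ closedBall x r, u y ≤ (h y : EReal)

/-- The positive part of an extended real number, as a member of `ℝ≥0∞`. -/
def erealPos (x : EReal) : ℝ≥0∞ := if x = ⊤ then ⊤ else ENNReal.ofReal x.toReal

/-- The integral of an `EReal`-valued function against a measure, with values in `EReal`:
the lower integral of the positive part minus the lower integral of the negative part. -/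
def eInt {d : ℕ} (μ : Measure (Euc d)) (u : Euc d → EReal) : EReal :=
  ((∫⁻ x, erealPos (u x) ∂μ : ℝ≥0∞) : EReal) -
    ((∫⁻ x, erealPos (-(u x)) ∂μ : ℝ≥0∞) : EReal)

/-- The (closed) support of a measure: points all of whose open neighbourhoods
have strictly positive measure. -/
def msupp {d : ℕ} (μ : Measure (Euc d)) : Set (Euc d) :=
  {x | ∀ U : Set (Euc d), IsOpen U → x ∈ U → 0 < μ U}

/-- A finite positive Borel measure whose support is a compact subset of `O`. -/
def MeasCompIn {d : ℕ} (μ : Measure (Euc d)) (O : Set (Euc d)) : Prop :=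
  IsCompact (msupp μ) ∧ msupp μ ⊆ O ∧ μ (msupp μ)ᶜ = 0 ∧ μ Set.univ < ⊤

/-- The *inward filling* of `S` with respect to `O`: the union of `S` with all connected
components of `O \ S` that are relatively compact in `O`. -/
def infill {X : Type*} [TopologicalSpace X] (O S : Set X) : Set X :=
  S ∪ {y | ∃ x ∈ O \ S, y ∈ connectedComponentIn (O \ S) x ∧
      IsCompact (closure (connectedComponentIn (O \ S) x)) ∧
      closure (connectedComponentIn (O \ S) x) ⊆ O}

/-- Every point of `U` carries a closed ball in `U` over which `f` has the sub-mean-value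
property. -/
def LocSub {d : ℕ} (f : Euc d → ℝ) (U : Set (Euc d)) : Prop :=
  ∀ y ∈ U, ∃ r : ℝ, 0 < r ∧ closedBall y r ⊆ U ∧
    f y * volume.real (closedBall y r) ≤ ∫ z in closedBall y r, f z

lemma volume_real_closedBall_pos {d : ℕ} (y : Euc d) {r : ℝ} (hr : 0 < r) :
    0 < volume.real (closedBall y r) :=
  ENNReal.toReal_pos (measure_closedBall_pos volume y hr).ne' measure_closedBall_lt_top.ne

lemma HarmOn.integral_eq {d : ℕ} {h : Euc d → ℝ} {O : Set (Euc d)} (hh : HarmOn h O) {x : Euc d}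
    {r : ℝ} (hr : 0 < r) (hx : closedBall x r ⊆ O) :
    ∫ z in closedBall x r, h z = h x * volume.real (closedBall x r) := by
  have h1 := hh.2 x r hr hx
  rw [setAverage_eq, smul_eq_mul] at h1
  have := volume_real_closedBall_pos x hr
  rw [h1]; field_simp

lemma harmOn_of_integral_eq {d : ℕ} {h : Euc d → ℝ} {O : Set (Euc d)} (hc : ContinuousOn h O)
    (hi : ∀ x : Euc d, ∀ r : ℝ, 0 < r → closedBall x r ⊆ O →
      ∫ z in closedBall x r, h z = h x * volume.real (closedBall x r)) : HarmOn h O := by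
  refine ⟨hc, fun x r hr hx => ?_⟩
  have := volume_real_closedBall_pos x hr
  rw [setAverage_eq, smul_eq_mul, hi x r hr hx]; field_simp

lemma HarmOn.mono {d : ℕ} {h : Euc d → ℝ} {O O' : Set (Euc d)} (hh : HarmOn h O) (hO : O' ⊆ O) :
    HarmOn h O' :=
  ⟨hh.1.mono hO, fun x r hr hx => hh.2 x r hr (hx.trans hO)⟩

lemma HarmOn.neg {d : ℕ} {h : Euc d → ℝ} {O : Set (Euc d)} (hh : HarmOn h O) :
    HarmOn (fun x => - h x) O := by
  refine harmOn_of_integral_eq hh.1.neg fun x r hr hx => ?_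
  rw [integral_neg, hh.integral_eq hr hx]; ring

lemma HarmOn.add_const {d : ℕ} {h : Euc d → ℝ} {O : Set (Euc d)} (hh : HarmOn h O) (c : ℝ) :
    HarmOn (fun x => h x + c) O := by
  refine harmOn_of_integral_eq (hh.1.add continuousOn_const) fun x r hr hx => ?_
  rw [integral_add, hh.integral_eq hr hx, setIntegral_const]
  · simp only [smul_eq_mul]; ring
  · exact (hh.1.mono hx).integrableOn_compact (isCompact_closedBall x r)
  · exact continuousOn_const.integrableOn_compact (isCompact_closedBall x r)

lemma harmOn_const {d : ℕ} (c : ℝ) (O : Set (Euc d)) : HarmOn (fun _ => c) O := by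
  refine harmOn_of_integral_eq continuousOn_const fun x r hr hx => ?_
  rw [setIntegral_const]; simp only [smul_eq_mul]; ring

lemma HarmOn.locSub {d : ℕ} {h : Euc d → ℝ} {O : Set (Euc d)} (hO : IsOpen O) (hh : HarmOn h O) :
    LocSub h O := by
  intro y hy
  obtain ⟨r, hr, hb⟩ := nhds_basis_closedBall.mem_iff.1 (hO.mem_nhds hy)
  exact ⟨r, hr, hb, (hh.integral_eq hr hb).ge⟩

lemma LocSub.sub_harmOn {d : ℕ} {f h : Euc d → ℝ} {O : Set (Euc d)} (hf : LocSub f O)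
    (hfc : ContinuousOn f O) (hh : HarmOn h O) : LocSub (fun x => f x - h x) O := by
  intro y hy
  obtain ⟨r, hr, hb, hm⟩ := hf y hy
  refine ⟨r, hr, hb, ?_⟩
  rw [integral_sub, hh.integral_eq hr hb]
  · linarith
  · exact (hfc.mono hb).integrableOn_compact (isCompact_closedBall y r)
  · exact (hh.1.mono hb).integrableOn_compact (isCompact_closedBall y r)

/-- If a continuous function bounded above by `M` has mean at least `M` over a closed ball, it
equals `M` on the open ball. -/
lemma eq_on_ball_of_le_of_mean_ge {d : ℕ} {f : Euc d → ℝ} {y : Euc d} {r M : ℝ}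
    (hc : ContinuousOn f (closedBall y r)) (hle : ∀ z ∈ closedBall y r, f z ≤ M)
    (hm : M * volume.real (closedBall y r) ≤ ∫ z in closedBall y r, f z) :
    ∀ z ∈ ball y r, f z = M := by
  have hi := hc.integrableOn_compact (μ := volume) (isCompact_closedBall y r)
  have hic : IntegrableOn (fun _ : Euc d => M) (closedBall y r) :=
    continuousOn_const.integrableOn_compact (isCompact_closedBall y r)
  have h0 : ∫ z in closedBall y r, (M - f z) = 0 := by
    apply le_antisymm
    · rw [integral_sub hic hi, setIntegral_const, smul_eq_mul]; linarith
    · exact setIntegral_nonneg isClosed_closedBall.measurableSet fun z hz => by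
        linarith [hle z hz]
  have h1 := (setIntegral_eq_zero_iff_of_nonneg_ae (f := fun z => M - f z)
    ((ae_restrict_iff' isClosed_closedBall.measurableSet).2
      (Eventually.of_forall fun z hz => by simpa using hle z hz)) (hic.sub hi)).1 h0
  have h2 : (fun z => M - f z) =ᵐ[volume.restrict (ball y r)] (fun _ => (0:ℝ)) :=
    ae_restrict_of_ae_restrict_of_subset ball_subset_closedBall h1
  have h3 := Measure.eqOn_open_of_ae_eq h2 isOpen_ball
    (continuousOn_const.sub (hc.mono ball_subset_closedBall)) continuousOn_const
  intro z hz
  have := h3 hz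
  simp only at this
  linarith

lemma LocSub.eq_of_isPreconnected {d : ℕ} {f : Euc d → ℝ} {U T : Set (Euc d)} {M : ℝ}
    (hf : LocSub f U) (hc : ContinuousOn f U) (hle : ∀ z ∈ U, f z ≤ M) (hT : IsPreconnected T)
    (hTU : T ⊆ U) {x : Euc d} (hx : x ∈ T) (hfx : f x = M) : ∀ z ∈ T, f z = M := by
  set A : Set (Euc d) := {y | y ∈ U ∧ f y = M} with hA
  have hopen : IsOpen A := by
    rw [Metric.isOpen_iff]
    rintro y ⟨hyU, hyM⟩
    obtain ⟨r, hr, hb, hm⟩ := hf y hyU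
    refine ⟨r, hr, fun z hz => ⟨hb (ball_subset_closedBall hz), ?_⟩⟩
    exact eq_on_ball_of_le_of_mean_ge (hc.mono hb) (fun z hz => hle z (hb hz))
      (by rw [← hyM]; exact hm) z hz
  have hsub : T ⊆ A := by
    refine hT.subset_of_closure_inter_subset hopen ⟨x, hx, hTU hx, hfx⟩ ?_
    rintro z ⟨hzA, hzT⟩
    refine ⟨hTU hzT, ?_⟩
    have : z ∈ closure A := hzA
    have h1 : f z ∈ closure (f '' A) :=
      ((hc z (hTU hzT)).mono (fun y hy => hy.1)).mem_closure_image this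
    have h2 : f '' A ⊆ {M} := by rintro _ ⟨y, hy, rfl⟩; exact hy.2
    have h3 := closure_mono h2 h1
    simpa using h3
  exact fun z hz => (hsub hz).2

/-- The maximum principle on balls. -/
lemma LocSub.le_of_le_sphere {d : ℕ} [NeZero d] {f : Euc d → ℝ} {c : Euc d} {R B : ℝ} (hR : 0 < R)
    (hf : LocSub f (ball c R)) (hc : ContinuousOn f (closedBall c R))
    (hs : ∀ z ∈ sphere c R, f z ≤ B) : ∀ z ∈ closedBall c R, f z ≤ B := by
  obtain ⟨y, hy, hmax⟩ := (isCompact_closedBall c R).exists_isMaxOn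
    ⟨c, mem_closedBall_self hR.le⟩ hc
  have hmax' : ∀ z ∈ closedBall c R, f z ≤ f y := fun z hz => hmax hz
  suffices f y ≤ B from fun z hz => (hmax' z hz).trans this
  rcases (mem_closedBall.1 hy).lt_or_eq with h | h
  · have hball : ∀ z ∈ ball c R, f z = f y :=
      hf.eq_of_isPreconnected (hc.mono ball_subset_closedBall)
        (fun z hz => hmax' z (ball_subset_closedBall hz)) (convex_ball c R).isPreconnected
        subset_rfl (mem_ball.2 h) rfl
    obtain ⟨w, hw⟩ : (sphere c R).Nonempty := NormedSpace.sphere_nonempty.2 hR.le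
    have hwc : w ∈ closedBall c R := sphere_subset_closedBall hw
    have hcl : w ∈ closure (ball c R) := by rwa [closure_ball c hR.ne']
    have h1 : f w ∈ closure (f '' ball c R) :=
      ((hc w hwc).mono ball_subset_closedBall).mem_closure_image hcl
    have h2 : f '' ball c R ⊆ {f y} := by rintro _ ⟨z, hz, rfl⟩; exact hball z hz
    have h3 : f w = f y := by simpa using closure_mono h2 h1
    rw [← h3]; exact hs w hw
  · exact hs y (mem_sphere.2 h)

/-- A continuous function with the local sub-mean-value property is subharmonic. -/
lemma LocSub.sbhOn {d : ℕ} [NeZero d] {f : Euc d → ℝ} {O : Set (Euc d)}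
    (hf : ∀ U, IsOpen U → U ⊆ O → LocSub f U)
    (hc : ContinuousOn f O) : SbhOn (fun x => (f x : EReal)) O := by
  refine ⟨?_, fun x _ => EReal.coe_lt_top _, ?_⟩
  · exact (continuous_coe_real_ereal.comp_continuousOn hc).upperSemicontinuousOn
  · intro x r hr hb h hhc hh hs y hy
    have hfb := (hf _ isOpen_ball (ball_subset_closedBall.trans hb)).sub_harmOn
      (hc.mono (ball_subset_closedBall.trans hb)) hh
    have := hfb.le_of_le_sphere (B := 0) hr ((hc.mono hb).sub hhc)
      (fun z hz => by have := EReal.coe_le_coe_iff.1 (hs z hz); linarith) y hy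
    exact EReal.coe_le_coe_iff.2 (by linarith)

lemma HarmOn.sbhOn {d : ℕ} [NeZero d] {f : Euc d → ℝ} {O : Set (Euc d)}
    (hf : HarmOn f O) : SbhOn (fun x => (f x : EReal)) O :=
  LocSub.sbhOn (fun _ hU hUO => (hf.mono hUO).locSub hU) hf.1

lemma lipschitzWith_min_norm_sq {d : ℕ} :
    LipschitzWith 1 (fun z : Euc d => min ((‖z‖ ^ 2 - 1) / 2) 0) := by
  refine LipschitzWith.of_dist_le_mul fun a b => ?_
  have key : ∀ s t : ℝ, 0 ≤ s → 0 ≤ t →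
      min ((s ^ 2 - 1) / 2) 0 - min ((t ^ 2 - 1) / 2) 0 ≤ |s - t| := by
    intro s t hs ht
    rcases le_total 1 t with h1 | h1
    · rw [min_eq_right (a := (t ^ 2 - 1) / 2) (by nlinarith)]
      have := min_le_right ((s ^ 2 - 1) / 2) 0
      have := abs_nonneg (s - t)
      linarith
    · rw [min_eq_left (a := (t ^ 2 - 1) / 2) (by nlinarith)]
      rcases le_total s t with h2 | h2
      · have := min_le_left ((s ^ 2 - 1) / 2) 0
        have := abs_nonneg (s - t)
        nlinarith
      · rw [abs_of_nonneg (by linarith)]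
        rcases le_total s 1 with h3 | h3
        · have := min_le_left ((s ^ 2 - 1) / 2) 0
          nlinarith
        · have := min_le_right ((s ^ 2 - 1) / 2) 0
          nlinarith
  have h1 := key ‖a‖ ‖b‖ (norm_nonneg _) (norm_nonneg _)
  have h2 := key ‖b‖ ‖a‖ (norm_nonneg _) (norm_nonneg _)
  have h3 := abs_norm_sub_norm_le a b
  rw [abs_sub_comm] at h2
  rw [Real.dist_eq, dist_eq_norm, NNReal.coe_one, one_mul, abs_le]
  constructor <;> linarith

lemma hasCompactSupport_min_norm_sq {d : ℕ} :
    HasCompactSupport (fun z : Euc d => min ((‖z‖ ^ 2 - 1) / 2) 0) := by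
  refine HasCompactSupport.intro (isCompact_closedBall 0 1) fun z hz => ?_
  have : 1 < ‖z‖ := by simpa using hz
  exact min_eq_right (by nlinarith)

lemma lineDeriv_min_norm_sq_of_lt {d : ℕ} {z : Euc d} (hz : ‖z‖ < 1) (v : Euc d) :
    lineDeriv ℝ (fun z : Euc d => min ((‖z‖ ^ 2 - 1) / 2) 0) z v = inner ℝ z v := by
  have h1 : HasFDerivAt (fun z : Euc d => (‖z‖ ^ 2 - 1) / 2) (innerSL ℝ z) z := by
    have h := (((hasStrictFDerivAt_norm_sq z).hasFDerivAt).sub_const 1).const_mul (1 / 2 : ℝ)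
    have h3 : (1 / 2 : ℝ) • (2 : ℕ) • innerSL ℝ z = innerSL ℝ z := by
      ext y; simp
    rw [h3] at h
    exact h.congr_of_eventuallyEq (Eventually.of_forall fun y => by ring)
  have h2 : (fun z : Euc d => min ((‖z‖ ^ 2 - 1) / 2) 0) =ᶠ[𝓝 z]
      (fun z : Euc d => (‖z‖ ^ 2 - 1) / 2) := by
    filter_upwards [(isOpen_lt continuous_norm continuous_const).mem_nhds hz] with y hy
    have hy : ‖y‖ < 1 := hy
    exact min_eq_left (by nlinarith [norm_nonneg y])
  rw [(h1.congr_of_eventuallyEq h2).hasLineDerivAt v |>.lineDeriv]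
  simp

lemma lineDeriv_min_norm_sq_of_gt {d : ℕ} {z : Euc d} (hz : 1 < ‖z‖) (v : Euc d) :
    lineDeriv ℝ (fun z : Euc d => min ((‖z‖ ^ 2 - 1) / 2) 0) z v = 0 := by
  have h1 : HasFDerivAt (fun _ : Euc d => (0:ℝ)) (0 : Euc d →L[ℝ] ℝ) z := hasFDerivAt_const _ _
  have h2 : (fun z : Euc d => min ((‖z‖ ^ 2 - 1) / 2) 0) =ᶠ[𝓝 z] (fun _ : Euc d => (0:ℝ)) := by
    filter_upwards [(isOpen_lt continuous_const continuous_norm).mem_nhds hz] with y hy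
    have hy : 1 < ‖y‖ := hy
    exact min_eq_right (by nlinarith [norm_nonneg y])
  rw [(h1.congr_of_eventuallyEq h2).hasLineDerivAt v |>.lineDeriv]
  simp

/-- Integration by parts on the unit ball against a coordinate. -/
lemma integral_ball_coord_mul {d : ℕ} [NeZero d] {G : Euc d → ℝ} {C : NNReal}
    (hG : LipschitzWith C G) (i : Fin d) :
    ∫ z in closedBall (0 : Euc d) 1, z i * G z =
      - ∫ z, lineDeriv ℝ G z (EuclideanSpace.single i 1) * min ((‖z‖ ^ 2 - 1) / 2) 0 := by
  rw [LipschitzWith.integral_lineDeriv_mul_eq (μ := volume) hG (lipschitzWith_min_norm_sq (d := d))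
    hasCompactSupport_min_norm_sq, ← integral_neg,
    ← integral_indicator isClosed_closedBall.measurableSet]
  refine integral_congr_ae ?_
  have hs : ∀ᵐ z : Euc d, z ∉ sphere (0 : Euc d) 1 :=
    measure_eq_zero_iff_ae_notMem.1 (Measure.addHaar_sphere volume 0 1)
  filter_upwards [hs] with z hz
  have hz' : ‖z‖ ≠ 1 := by simpa using hz
  rcases lt_or_gt_of_ne hz' with h | h
  · rw [indicator_of_mem (by simpa using h.le), lineDeriv_min_norm_sq_of_lt h]
    simp [inner_neg_right, EuclideanSpace.inner_single_right]
  · rw [indicator_of_notMem (by simpa using h), lineDeriv_min_norm_sq_of_gt h]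
    simp

/-- The mean value property for compactly supported `C²` functions that are harmonic in a ball. -/
lemma integral_closedBall_of_laplacian_eq_zero {d : ℕ} [NeZero d] {f : Euc d → ℝ}
    (hf : ContDiff ℝ 2 f) (hfc : HasCompactSupport f) {x : Euc d} {r : ℝ} (hr : 0 < r)
    (hΔ : ∀ y ∈ ball x r, ∑ i, fderiv ℝ (fun w => fderiv ℝ f w (EuclideanSpace.single i 1)) y
      (EuclideanSpace.single i 1) = 0) :
    ∫ z in closedBall x r, f z = f x * volume.real (closedBall x r) := by
  set e : Fin d → Euc d := fun i => EuclideanSpace.single i 1 with he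
  have hf1 : ContDiff ℝ 1 (fderiv ℝ f) := hf.fderiv_right (by norm_num)
  have hfd : Continuous (fderiv ℝ f) := hf1.continuous
  have hfdc : HasCompactSupport (fderiv ℝ f) := hfc.fderiv ℝ
  obtain ⟨C, hC⟩ := hfd.bounded_above_of_compact_support hfdc
  set g : Fin d → Euc d → ℝ := fun i w => fderiv ℝ f w (e i) with hg
  have hg1 : ∀ i, ContDiff ℝ 1 (g i) := fun i => hf1.clm_apply contDiff_const
  have hgc : ∀ i, HasCompactSupport (g i) := fun i => 
    hfdc.comp_left (g := fun L : Euc d →L[ℝ] ℝ => L (e i)) rfl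
  have hgl : ∀ i, ∃ K, LipschitzWith K (g i) := fun i =>
    ⟨_, ((hg1 i).lipschitzWith_of_hasCompactSupport (hgc i) (by norm_num)).choose_spec⟩
  set B := closedBall (0 : Euc d) 1 with hB
  have hBm : MeasurableSet B := isClosed_closedBall.measurableSet
  have hBc : IsCompact B := isCompact_closedBall 0 1
  set M : ℝ → ℝ := fun t => ∫ z in B, f (x + t • z) with hM
  have hderiv : ∀ t, HasDerivAt M (∫ z in B, fderiv ℝ f (x + t • z) z) t := by
    intro t
    refine (hasDerivAt_integral_of_dominated_loc_of_deriv_le (μ := volume.restrict B)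
      (F := fun t z => f (x + t • z))
      (F' := fun t z => fderiv ℝ f (x + t • z) z) (s := univ) (bound := fun _ => C)
      univ_mem ?_ ?_ ?_ ?_ ?_ ?_).2
    · exact Eventually.of_forall fun s =>
        (hf.continuous.comp (by fun_prop)).aestronglyMeasurable
    · exact ((hf.continuous.comp (by fun_prop)).continuousOn).integrableOn_compact hBc
    · exact ((hfd.comp (by fun_prop : Continuous fun z => x + t • z)).clm_apply
        continuous_id).aestronglyMeasurable
    · refine (ae_restrict_iff' hBm).2 (Eventually.of_forall fun z hz s _ => ?_)
      have hz1 : ‖z‖ ≤ 1 := by simpa [hB] using hz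
      have hC0 : 0 ≤ C := (norm_nonneg _).trans (hC x)
      calc ‖fderiv ℝ f (x + s • z) z‖ ≤ ‖fderiv ℝ f (x + s • z)‖ * ‖z‖ :=
            ContinuousLinearMap.le_opNorm _ _
        _ ≤ C * 1 := mul_le_mul (hC _) hz1 (norm_nonneg _) hC0
        _ = C := mul_one C
    · exact continuousOn_const.integrableOn_compact hBc
    · refine Eventually.of_forall fun z s _ => ?_
      have h1 : HasFDerivAt f (fderiv ℝ f (x + s • z)) (x + s • z) :=
        (hf.differentiable (by norm_num)).differentiableAt.hasFDerivAt
      have h2 : HasDerivAt (fun s : ℝ => x + s • z) z s := by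
        simpa using ((hasDerivAt_id s).smul_const z).const_add x
      exact h1.comp_hasDerivAt s h2
  have hzero : ∀ t ∈ Ico (0:ℝ) r, ∫ z in B, fderiv ℝ f (x + t • z) z = 0 := by
    intro t ht
    have hGl : ∀ i, ∃ K, LipschitzWith K (fun z : Euc d => g i (x + t • z)) := by
      intro i
      obtain ⟨K, hK⟩ := hgl i
      have hA : LipschitzWith ‖t‖₊ (fun z : Euc d => x + t • z) := by
        refine LipschitzWith.of_dist_le_mul fun a b => ?_
        rw [dist_add_left, dist_smul₀, coe_nnnorm]
      exact ⟨_, hK.comp hA⟩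
    have hsplit : ∀ z : Euc d, fderiv ℝ f (x + t • z) z = ∑ i, z i * g i (x + t • z) := by
      intro z
      have hz : z = ∑ i, z i • e i := by
        ext j
        simp [he, Finset.sum_apply, Pi.single_apply]
      conv_lhs => rw [hz]
      rw [map_sum]
      simp only [map_smul, smul_eq_mul, ← hz, hg]
    have hld : ∀ i z, lineDeriv ℝ (fun z : Euc d => g i (x + t • z)) z (e i) =
        t * fderiv ℝ (g i) (x + t • z) (e i) := by
      intro i z
      have h1 : HasFDerivAt (g i) (fderiv ℝ (g i) (x + t • z)) (x + t • z) :=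
        ((hg1 i).differentiable (by norm_num)).differentiableAt.hasFDerivAt
      have h2 : HasFDerivAt (fun z : Euc d => x + t • z) (t • ContinuousLinearMap.id ℝ (Euc d)) z :=
        ((hasFDerivAt_id z).const_smul t).const_add x
      have h3 : HasFDerivAt (fun z : Euc d => g i (x + t • z))
          ((fderiv ℝ (g i) (x + t • z)).comp (t • ContinuousLinearMap.id ℝ (Euc d))) z :=
        HasFDerivAt.comp (g := g i) z h1 h2
      rw [(h3.hasLineDerivAt (e i)).lineDeriv]
      simp
    have hcont : ∀ i, Continuous fun z : Euc d => g i (x + t • z) := fun i =>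
      (hg1 i).continuous.comp (by fun_prop)
    simp only [hsplit]
    rw [integral_finsetSum]
    · have : ∀ i, ∫ z in B, z i * g i (x + t • z) =
          - ∫ z : Euc d, t * fderiv ℝ (g i) (x + t • z) (e i) * min ((‖z‖ ^ 2 - 1) / 2) 0 := by
        intro i
        obtain ⟨K, hK⟩ := hGl i
        rw [integral_ball_coord_mul hK i]
        congr 1
        refine integral_congr_ae (Eventually.of_forall fun z => ?_)
        simp only
        rw [← hld i z]
      simp only [this]
      rw [Finset.sum_neg_distrib, ← integral_finsetSum]
      · rw [neg_eq_zero]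
        refine integral_eq_zero_of_ae (Eventually.of_forall fun z => ?_)
        simp only [Pi.zero_apply]
        rw [← Finset.sum_mul, ← Finset.mul_sum]
        rcases lt_or_ge ‖z‖ 1 with h | h
        · rw [hΔ (x + t • z)]
          · simp
          · rw [mem_ball, dist_eq_norm, add_sub_cancel_left, norm_smul, Real.norm_eq_abs,
              abs_of_nonneg ht.1]
            nlinarith [ht.1, ht.2, norm_nonneg z]
        · rw [min_eq_right (by nlinarith)]; simp
      · intro i _
        refine Continuous.integrable_of_hasCompactSupport ?_ ?_
        · refine Continuous.mul (continuous_const.mul ?_) lipschitzWith_min_norm_sq.continuous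
          exact (((hg1 i).continuous_fderiv (by norm_num)).comp
            (by fun_prop : Continuous fun z => x + t • z)).clm_apply continuous_const
        · exact hasCompactSupport_min_norm_sq.mul_left
    · intro i _
      exact (Continuous.mul (by fun_prop) (hcont i)).continuousOn.integrableOn_compact hBc
  have hconst : M r = M 0 := by
    refine constant_of_has_deriv_right_zero (a := 0) (b := r)
      (fun t _ => (hderiv t).continuousAt.continuousWithinAt) (fun t ht => ?_) r ⟨hr.le, le_rfl⟩
    have := (hderiv t).hasDerivWithinAt (s := Ici t)
    rwa [hzero t ht] at this
  have hM0 : M 0 = f x * volume.real B := by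
    simp only [hM, zero_smul, add_zero]
    rw [setIntegral_const, smul_eq_mul, mul_comm]
  have hMr : ∫ z in closedBall x r, f z = r ^ d * M r := by
    have h1 : ∫ z in closedBall x r, f z =
        ∫ z, (closedBall x r).indicator f (x + z) := by
      rw [integral_add_left_eq_self (μ := volume) ((closedBall x r).indicator f) x,
        integral_indicator isClosed_closedBall.measurableSet]
    have h2 := Measure.integral_comp_smul (volume : Measure (Euc d))
      (fun z => (closedBall x r).indicator f (x + z)) r
    have h3 : M r = ∫ z, (closedBall x r).indicator f (x + r • z) := by
      simp only [hM]
      rw [← integral_indicator hBm]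
      refine integral_congr_ae (Eventually.of_forall fun z => ?_)
      simp only [indicator]
      have : z ∈ B ↔ x + r • z ∈ closedBall x r := by
        rw [hB, mem_closedBall, mem_closedBall, dist_eq_norm, dist_eq_norm, add_sub_cancel_left,
          sub_zero, norm_smul, Real.norm_eq_abs, abs_of_pos hr]
        constructor
        · intro h; nlinarith
        · intro h; by_contra! h'; nlinarith
      by_cases hz : z ∈ B
      · rw [if_pos hz, if_pos (this.1 hz)]
      · rw [if_neg hz, if_neg (fun h => hz (this.2 h))]
    rw [h1, h3, h2]
    rw [finrank_euclideanSpace, Fintype.card_fin, smul_eq_mul, abs_of_pos (by positivity)]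
    field_simp
  have hvol : volume.real (closedBall x r) = r ^ d * volume.real B := by
    rw [hB, Measure.real, Measure.addHaar_closedBall' volume x hr.le, ENNReal.toReal_mul,
      ENNReal.toReal_ofReal (by positivity)]
    simp [Measure.real]
  rw [hMr, hconst, hM0, hvol]; ring

/-- A `C²` function with vanishing Laplacian has the mean value property. -/
lemma harmOn_of_laplacian_eq_zero {d : ℕ} [NeZero d] {f : Euc d → ℝ} {U : Set (Euc d)}
    (hU : IsOpen U) (hf : ContDiffOn ℝ 2 f U)
    (hΔ : ∀ y ∈ U, ∑ i, fderiv ℝ (fun w => fderiv ℝ f w (EuclideanSpace.single i 1)) y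
      (EuclideanSpace.single i 1) = 0) : HarmOn f U := by
  refine harmOn_of_integral_eq hf.continuousOn fun x r hr hx => ?_
  obtain ⟨ε, hε, hεU⟩ := (isCompact_closedBall x r).exists_cthickening_subset_open hU hx
  have hsub : closedBall x (r + ε) ⊆ U := by
    rw [add_comm, ← cthickening_closedBall hε.le hr.le]
    exact hεU
  let χ : ContDiffBump x := ⟨r + ε / 2, r + ε, by linarith, by linarith⟩
  have hcd : ContDiff ℝ 2 (fun y => χ y * f y) := by
    rw [contDiff_iff_contDiffAt]
    intro y
    by_cases hy : y ∈ U
    · exact χ.contDiff.contDiffAt.mul (hf.contDiffAt (hU.mem_nhds hy))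
    · have : y ∈ (tsupport χ)ᶜ := by
        rw [χ.tsupport_eq]; exact fun h => hy (hsub h)
      have hev : (fun y => χ y * f y) =ᶠ[𝓝 y] fun _ => 0 := by
        filter_upwards [(isClosed_tsupport χ).isOpen_compl.mem_nhds this] with w hw
        rw [image_eq_zero_of_notMem_tsupport hw, zero_mul]
      exact contDiffAt_const.congr_of_eventuallyEq hev
  have hcs : HasCompactSupport (fun y => χ y * f y) := χ.hasCompactSupport.mul_right
  have hone : ∀ y ∈ ball x (r + ε / 2), (fun y => χ y * f y) =ᶠ[𝓝 y] f := by
    intro y hy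
    filter_upwards [isOpen_ball.mem_nhds hy] with w hw
    rw [χ.one_of_mem_closedBall (ball_subset_closedBall hw), one_mul]
  have hin : ∀ y ∈ closedBall x r, χ y * f y = f y := fun y hy =>
    (hone y (closedBall_subset_ball (by linarith) hy)).eq_of_nhds
  have hmain := integral_closedBall_of_laplacian_eq_zero hcd hcs (x := x) hr (fun y hy => ?_)
  · rw [setIntegral_congr_fun isClosed_closedBall.measurableSet hin,
      hin x (mem_closedBall_self hr.le)] at hmain
    exact hmain
  · have hyr : y ∈ ball x (r + ε / 2) := ball_subset_ball (by linarith) hy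
    rw [← hΔ y (hx (ball_subset_closedBall hy))]
    refine Finset.sum_congr rfl fun i _ => ?_
    congr 1
    refine Filter.EventuallyEq.fderiv_eq ?_
    filter_upwards [isOpen_ball.mem_nhds hyr] with w hw
    rw [(hone w hw).fderiv_eq]

lemma setIntegral_closedBall_sub {d : ℕ} (f : Euc d → ℝ) (x y : Euc d) (r : ℝ) :
    ∫ z in closedBall y r, f (z - x) = ∫ z in closedBall (y - x) r, f z := by
  rw [← integral_indicator isClosed_closedBall.measurableSet,
    ← integral_indicator isClosed_closedBall.measurableSet,
    ← integral_sub_right_eq_self (μ := volume) ((closedBall (y - x) r).indicator f) x]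
  refine integral_congr_ae (Eventually.of_forall fun z => ?_)
  have : z ∈ closedBall y r ↔ z - x ∈ closedBall (y - x) r := by
    simp [mem_closedBall, dist_eq_norm]
  simp only [indicator]
  by_cases hz : z ∈ closedBall y r
  · rw [if_pos hz, if_pos (this.1 hz)]
  · rw [if_neg hz, if_neg (fun h => hz (this.2 h))]

lemma volume_real_closedBall_sub {d : ℕ} (x y : Euc d) (r : ℝ) :
    volume.real (closedBall (y - x) r) = volume.real (closedBall y r) := by
  have := setIntegral_closedBall_sub (fun _ => (1:ℝ)) x y r
  simpa using this.symm

lemma HarmOn.comp_sub {d : ℕ} {h : Euc d → ℝ} {O : Set (Euc d)} (hh : HarmOn h O) (x : Euc d) :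
    HarmOn (fun y => h (y - x)) {y | y - x ∈ O} := by
  refine harmOn_of_integral_eq (hh.1.comp (by fun_prop) fun y hy => hy) fun y r hr hy => ?_
  rw [setIntegral_closedBall_sub h, hh.integral_eq hr, volume_real_closedBall_sub]
  intro z hz
  have := hy (show z + x ∈ closedBall y r by
    rw [mem_closedBall, dist_eq_norm] at hz ⊢
    rwa [show z + x - y = z - (y - x) by abel])
  simpa using this

/-- The profile of the fundamental solution as a function of the squared radius. -/
def fundProfile (d : ℕ) (s : ℝ) : ℝ := ∫ t in (1:ℝ)..s, t ^ (-(d:ℝ) / 2)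

lemma hasDerivAt_fundProfile (d : ℕ) {s : ℝ} (hs : 0 < s) :
    HasDerivAt (fundProfile d) (s ^ (-(d:ℝ) / 2)) s := by
  have hc : ContinuousOn (fun t : ℝ => t ^ (-(d:ℝ) / 2)) (Ioi 0) := fun t ht =>
    (Real.continuousAt_rpow_const t _ (Or.inl (ne_of_gt ht))).continuousWithinAt
  refine intervalIntegral.integral_hasDerivAt_right ?_ ?_ ?_
  · refine (hc.mono ?_).intervalIntegrable
    intro t ht
    exact lt_of_lt_of_le (lt_min one_pos hs) ht.1
  · exact hc.stronglyMeasurableAtFilter isOpen_Ioi s hs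
  · exact hc.continuousAt (Ioi_mem_nhds hs)

lemma continuousOn_fundProfile (d : ℕ) : ContinuousOn (fundProfile d) (Ioi 0) := fun _ hs =>
  (hasDerivAt_fundProfile d hs).continuousAt.continuousWithinAt

lemma strictMonoOn_fundProfile (d : ℕ) : StrictMonoOn (fundProfile d) (Ioi 0) := by
  refine strictMonoOn_of_deriv_pos (convex_Ioi 0) (continuousOn_fundProfile d) fun s hs => ?_
  rw [interior_Ioi] at hs
  rw [(hasDerivAt_fundProfile d hs).deriv]
  exact Real.rpow_pos_of_pos hs _

lemma contDiffOn_fundProfile (d : ℕ) : ContDiffOn ℝ 2 (fundProfile d) (Ioi 0) := by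
  have : (2 : WithTop ℕ∞) = 1 + 1 := by norm_num
  rw [this, contDiffOn_succ_iff_deriv_of_isOpen isOpen_Ioi]
  refine ⟨fun s hs => (hasDerivAt_fundProfile d hs).differentiableAt.differentiableWithinAt,
    by simp, ?_⟩
  have h : ContDiffOn ℝ 1 (fun s : ℝ => s ^ (-(d:ℝ) / 2)) (Ioi 0) := fun s hs =>
    (Real.contDiffAt_rpow_const_of_ne (ne_of_gt hs)).contDiffWithinAt
  exact h.congr fun s hs => (hasDerivAt_fundProfile d hs).deriv

/-- The fundamental solution of the Laplacian, up to normalisation. -/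
def fundSol (d : ℕ) (z : Euc d) : ℝ := fundProfile d (‖z‖ ^ 2)

lemma hasFDerivAt_norm_sq {d : ℕ} (y : Euc d) :
    HasFDerivAt (fun z : Euc d => ‖z‖ ^ 2) (2 • innerSL ℝ y) y :=
  (hasStrictFDerivAt_norm_sq y).hasFDerivAt

lemma fderiv_fundSol_single {d : ℕ} {y : Euc d} (hy : y ≠ 0) (i : Fin d) :
    fderiv ℝ (fundSol d) y (EuclideanSpace.single i 1) =
      (‖y‖ ^ 2) ^ (-(d:ℝ) / 2) * (2 * y i) := by
  have hs : 0 < ‖y‖ ^ 2 := by positivity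
  have h : HasFDerivAt (fundSol d) ((‖y‖ ^ 2) ^ (-(d:ℝ) / 2) • (2 • innerSL ℝ y)) y :=
    (hasDerivAt_fundProfile d hs).comp_hasFDerivAt y (hasFDerivAt_norm_sq y)
  rw [h.fderiv]
  simp [EuclideanSpace.inner_single_right]

lemma fderiv_fderiv_fundSol_single {d : ℕ} {y : Euc d} (hy : y ≠ 0) (i : Fin d) :
    fderiv ℝ (fun w => fderiv ℝ (fundSol d) w (EuclideanSpace.single i 1)) y
      (EuclideanSpace.single i 1) =
      2 * (‖y‖ ^ 2) ^ (-(d:ℝ) / 2) - 2 * d * (‖y‖ ^ 2) ^ (-(d:ℝ) / 2 - 1) * (y i) ^ 2 := by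
  have hs : 0 < ‖y‖ ^ 2 := by positivity
  have hev : (fun w => fderiv ℝ (fundSol d) w (EuclideanSpace.single i 1)) =ᶠ[𝓝 y]
      fun w => (‖w‖ ^ 2) ^ (-(d:ℝ) / 2) * (2 * w i) := by
    filter_upwards [isOpen_ne.mem_nhds hy] with w hw
    exact fderiv_fundSol_single hw i
  rw [hev.fderiv_eq]
  have h1 : HasFDerivAt (fun w : Euc d => (‖w‖ ^ 2) ^ (-(d:ℝ) / 2))
      ((-(d:ℝ) / 2 * (‖y‖ ^ 2) ^ (-(d:ℝ) / 2 - 1)) • (2 • innerSL ℝ y)) y :=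
    HasDerivAt.comp_hasFDerivAt (h₂ := fun s : ℝ => s ^ (-(d:ℝ) / 2)) y
      (Real.hasDerivAt_rpow_const (Or.inl hs.ne')) (hasFDerivAt_norm_sq y)
  have h2 : HasFDerivAt (fun w : Euc d => 2 * w i)
      ((2:ℝ) • (EuclideanSpace.proj i : Euc d →L[ℝ] ℝ)) y :=
    ((EuclideanSpace.proj i : Euc d →L[ℝ] ℝ).hasFDerivAt).const_mul 2
  have h3 := (h1.mul h2).fderiv
  rw [show (fun w : Euc d => (‖w‖ ^ 2) ^ (-(d:ℝ) / 2) * (2 * w i)) =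
    (fun w : Euc d => (‖w‖ ^ 2) ^ (-(d:ℝ) / 2)) * fun w : Euc d => 2 * w i from rfl, h3]
  simp [EuclideanSpace.inner_single_right]
  ring

lemma harmOn_fundSol (d : ℕ) [NeZero d] : HarmOn (fundSol d) {0}ᶜ := by
  refine harmOn_of_laplacian_eq_zero isOpen_compl_singleton ?_ fun y hy => ?_
  · refine (contDiffOn_fundProfile d).comp (contDiff_norm_sq ℝ).contDiffOn fun y hy => ?_
    have : y ≠ 0 := hy
    show 0 < ‖y‖ ^ 2
    positivity
  · have hy : y ≠ 0 := hy
    have hs : 0 < ‖y‖ ^ 2 := by positivity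
    simp only [fderiv_fderiv_fundSol_single hy]
    rw [Finset.sum_sub_distrib, Finset.sum_const, Finset.card_univ,
      Fintype.card_fin, ← Finset.mul_sum,
      ← EuclideanSpace.real_norm_sq_eq, nsmul_eq_mul, Real.rpow_sub_one hs.ne']
    field_simp
    ring

/-- The fundamental solution truncated below at radius `ε`. -/
def regSol (d : ℕ) (ε : ℝ) (z : Euc d) : ℝ := fundProfile d (max (‖z‖ ^ 2) (ε ^ 2))

lemma continuous_regSol (d : ℕ) {ε : ℝ} (hε : 0 < ε) : Continuous (regSol d ε) :=
  (continuousOn_fundProfile d).comp_continuous (by fun_prop) fun z =>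
    lt_of_lt_of_le (by positivity : 0 < ε ^ 2) (le_max_right _ _)

lemma regSol_eq_fundSol {d : ℕ} {ε : ℝ} (hε : 0 < ε) {z : Euc d} (hz : ε ≤ ‖z‖) :
    regSol d ε z = fundSol d z := by
  rw [regSol, fundSol, max_eq_left (by gcongr)]

lemma fundSol_le_regSol {d : ℕ} {ε : ℝ} {z : Euc d} (hz : z ≠ 0) :
    fundSol d z ≤ regSol d ε z := by
  have : 0 < ‖z‖ ^ 2 := by positivity
  exact (strictMonoOn_fundProfile d).monotoneOn this (lt_max_of_lt_left this) (le_max_left _ _)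

lemma regSol_zero_le {d : ℕ} {ε : ℝ} (hε : 0 < ε) (z : Euc d) :
    regSol d ε 0 ≤ regSol d ε z := by
  have : 0 < ε ^ 2 := by positivity
  refine (strictMonoOn_fundProfile d).monotoneOn (lt_max_of_lt_right this)
    (lt_max_of_lt_right this) ?_
  gcongr
  simp

lemma regSol_zero_lt {d : ℕ} {ε : ℝ} (hε : 0 < ε) {z : Euc d} (hz : ε < ‖z‖) :
    regSol d ε 0 < regSol d ε z := by
  have h0 : 0 < ε ^ 2 := by positivity
  refine (strictMonoOn_fundProfile d) (lt_max_of_lt_right h0) (lt_max_of_lt_right h0) ?_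
  have : ε ^ 2 < ‖z‖ ^ 2 := by gcongr
  simpa [max_eq_left this.le] using And.intro (h0.trans this) this

lemma regSol_eq_zero_of_le {d : ℕ} {ε : ℝ} (hε : 0 < ε) {z : Euc d} (hz : ‖z‖ ≤ ε) :
    regSol d ε z = regSol d ε 0 := by
  have : ‖z‖ ^ 2 ≤ ε ^ 2 := by gcongr
  have h0 : 0 ≤ ε ^ 2 := by positivity
  simp only [regSol, norm_zero]
  rw [max_eq_right this, max_eq_right (by simpa using h0)]

lemma regSol_neg {d : ℕ} (ε : ℝ) (z : Euc d) : regSol d ε (-z) = regSol d ε z := by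
  simp [regSol]

lemma regSol_eq_of_norm_eq {d : ℕ} (ε : ℝ) {z w : Euc d} (h : ‖z‖ = ‖w‖) :
    regSol d ε z = regSol d ε w := by
  simp [regSol, h]

lemma locSub_regSol {d : ℕ} [NeZero d] {ε : ℝ} (hε : 0 < ε) (x : Euc d) {U : Set (Euc d)}
    (hU : IsOpen U) : LocSub (fun y => regSol d ε (y - x)) U := by
  intro y hy
  obtain ⟨r, hr, hb⟩ := nhds_basis_closedBall.mem_iff.1 (hU.mem_nhds hy)
  have hreg : ∀ (s : ℝ), IntegrableOn (fun z => regSol d ε (z - x)) (closedBall y s) := fun s =>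
    ((continuous_regSol d hε).comp (by fun_prop)).continuousOn.integrableOn_compact
      (isCompact_closedBall y s)
  rcases le_or_gt ε ‖y - x‖ with h | h
  · have hpos : 0 < ‖y - x‖ := hε.trans_le h
    set s := min r (‖y - x‖ / 2) with hs
    have hs0 : 0 < s := lt_min hr (by linarith)
    have hsub : closedBall y s ⊆ {z | z - x ∈ ({0}ᶜ : Set (Euc d))} := by
      intro z hz hzx
      have hzx : z = x := sub_eq_zero.1 hzx
      subst hzx
      rw [mem_closedBall, dist_comm, dist_eq_norm] at hz
      have := min_le_right r (‖y - z‖ / 2)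
      linarith
    refine ⟨s, hs0, (closedBall_subset_closedBall (min_le_left _ _)).trans hb, ?_⟩
    have hH := (harmOn_fundSol d).comp_sub x
    show regSol d ε (y - x) * _ ≤ _
    rw [regSol_eq_fundSol hε h, ← hH.integral_eq hs0 hsub]
    refine setIntegral_mono_on ?_ (hreg s) isClosed_closedBall.measurableSet fun z hz =>
      fundSol_le_regSol (hsub hz)
    exact (hH.1.mono hsub).integrableOn_compact (isCompact_closedBall y s)
  · refine ⟨r, hr, hb, ?_⟩
    show regSol d ε (y - x) * _ ≤ _
    rw [regSol_eq_zero_of_le hε h.le]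
    have : ∫ z in closedBall y r, regSol d ε 0 = regSol d ε 0 * volume.real (closedBall y r) := by
      rw [setIntegral_const, smul_eq_mul, mul_comm]
    rw [← this]
    exact setIntegral_mono_on (continuousOn_const.integrableOn_compact (isCompact_closedBall y r))
      (hreg r) isClosed_closedBall.measurableSet fun z _ => regSol_zero_le hε _

lemma sbhOn_regSol {d : ℕ} [NeZero d] {ε : ℝ} (hε : 0 < ε) (x : Euc d) (O : Set (Euc d)) :
    SbhOn (fun y => (regSol d ε (y - x) : EReal)) O :=
  LocSub.sbhOn (fun _ hU _ => locSub_regSol hε x hU)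
    ((continuous_regSol d hε).comp (by fun_prop)).continuousOn

/-- The polynomial function on Euclidean space attached to a multivariate polynomial. -/
def polyFun {d : ℕ} (p : MvPolynomial (Fin d) ℝ) (z : Euc d) : ℝ :=
  MvPolynomial.eval (fun i => z i) p

lemma hasFDerivAt_polyFun {d : ℕ} (p : MvPolynomial (Fin d) ℝ) (z : Euc d) :
    HasFDerivAt (polyFun p)
      (∑ i, polyFun (MvPolynomial.pderiv i p) z • (EuclideanSpace.proj i : Euc d →L[ℝ] ℝ)) z := by
  induction p using MvPolynomial.induction_on with
  | C a =>
    have : polyFun (MvPolynomial.C a : MvPolynomial (Fin d) ℝ) = fun _ => a := by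
      ext; simp [polyFun]
    rw [this]
    simpa [polyFun] using hasFDerivAt_const a z
  | add p q hp hq =>
    have : polyFun (p + q) = fun w => polyFun p w + polyFun q w := by ext; simp [polyFun]
    rw [this]
    refine (hp.add hq).congr_fderiv ?_
    simp [polyFun, add_smul, Finset.sum_add_distrib]
  | mul_X p j hp =>
    have : polyFun (p * MvPolynomial.X j) =
        fun w => polyFun p w * (EuclideanSpace.proj j : Euc d →L[ℝ] ℝ) w := by
      ext; simp [polyFun]
    rw [this]
    refine (hp.mul (EuclideanSpace.proj j : Euc d →L[ℝ] ℝ).hasFDerivAt).congr_fderiv ?_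
    symm
    simp only [MvPolynomial.pderiv_mul, polyFun, map_add, map_mul, MvPolynomial.eval_X,
      MvPolynomial.pderiv_X, add_smul, Finset.sum_add_distrib, Finset.smul_sum, smul_smul]
    rw [add_comm]
    congr 1
    · rw [Finset.sum_eq_single j]
      · simp
      · intro i _ hij
        simp [hij]
      · simp
    · exact Finset.sum_congr rfl fun i _ => by simp [mul_comm]

lemma fderiv_polyFun_single {d : ℕ} (p : MvPolynomial (Fin d) ℝ) (z : Euc d) (i : Fin d) :
    fderiv ℝ (polyFun p) z (EuclideanSpace.single i 1) = polyFun (MvPolynomial.pderiv i p) z := by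
  rw [(hasFDerivAt_polyFun p z).fderiv]
  simp [sum_apply, PiLp.single_apply]

lemma contDiff_polyFun {d : ℕ} (p : MvPolynomial (Fin d) ℝ) : ContDiff ℝ 2 (polyFun p) := by
  induction p using MvPolynomial.induction_on with
  | C a =>
    have : polyFun (MvPolynomial.C a : MvPolynomial (Fin d) ℝ) = fun _ => a := by
      ext; simp [polyFun]
    rw [this]; exact contDiff_const
  | add p q hp hq =>
    have : polyFun (p + q) = fun w => polyFun p w + polyFun q w := by ext; simp [polyFun]
    rw [this]; exact hp.add hq
  | mul_X p j hp =>
    have : polyFun (p * MvPolynomial.X j) =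
        fun w => polyFun p w * (EuclideanSpace.proj j : Euc d →L[ℝ] ℝ) w := by
      ext; simp [polyFun]
    rw [this]; exact hp.mul (EuclideanSpace.proj j : Euc d →L[ℝ] ℝ).contDiff

lemma continuous_polyFun {d : ℕ} (p : MvPolynomial (Fin d) ℝ) : Continuous (polyFun p) :=
  (contDiff_polyFun p).continuous

/-- The Laplacian of a polynomial. -/
def polyLaplacian (d : ℕ) : MvPolynomial (Fin d) ℝ →ₗ[ℝ] MvPolynomial (Fin d) ℝ :=
  ∑ i, (MvPolynomial.pderiv i).toLinearMap ∘ₗ (MvPolynomial.pderiv i).toLinearMap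

lemma harmOn_polyFun {d : ℕ} [NeZero d] {p : MvPolynomial (Fin d) ℝ}
    (hp : polyLaplacian d p = 0) (U : Set (Euc d)) : HarmOn (polyFun p) U := by
  refine HarmOn.mono (O := univ) ?_ (subset_univ U)
  refine harmOn_of_laplacian_eq_zero isOpen_univ (contDiff_polyFun p).contDiffOn fun y _ => ?_
  simp only [fderiv_polyFun_single]
  have := congrArg (fun q => polyFun q y) hp
  simpa [polyLaplacian, polyFun] using this

lemma totalDegree_pderiv_le {d : ℕ} {p : MvPolynomial (Fin d) ℝ} {n : ℕ}
    (hp : p.totalDegree ≤ n + 1) (i : Fin d) : (MvPolynomial.pderiv i p).totalDegree ≤ n := by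
  refine Finset.sup_le fun m hm => ?_
  have hm' : m + Finsupp.single i 1 ∈ p.support := by
    rw [MvPolynomial.mem_support_iff, MvPolynomial.coeff_pderiv] at hm
    exact MvPolynomial.mem_support_iff.2 (left_ne_zero_of_mul hm)
  have h1 := (MvPolynomial.le_totalDegree hm').trans hp
  rw [Finsupp.sum_add_index' (fun _ => rfl) (fun _ _ _ => rfl),
    Finsupp.sum_single_index rfl] at h1
  simpa using h1

lemma totalDegree_polyLaplacian_le {d : ℕ} {p : MvPolynomial (Fin d) ℝ} {n : ℕ}
    (hp : p.totalDegree ≤ n + 2) : (polyLaplacian d p).totalDegree ≤ n := by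
  rw [polyLaplacian, LinearMap.sum_apply]
  refine MvPolynomial.totalDegree_finsetSum_le fun i _ => ?_
  exact totalDegree_pderiv_le (totalDegree_pderiv_le hp i) i

/-- The polynomial `|X|² - t²`. -/
def sphPoly (d : ℕ) (t : ℝ) : MvPolynomial (Fin d) ℝ :=
  ∑ i, MvPolynomial.X i ^ 2 - MvPolynomial.C (t ^ 2)

lemma polyFun_sphPoly {d : ℕ} (t : ℝ) (z : Euc d) :
    polyFun (sphPoly d t) z = ‖z‖ ^ 2 - t ^ 2 := by
  simp [polyFun, sphPoly, EuclideanSpace.norm_sq_eq]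

lemma totalDegree_sphPoly_le (d : ℕ) (t : ℝ) : (sphPoly d t).totalDegree ≤ 2 := by
  rw [sphPoly, sub_eq_add_neg, ← map_neg]
  refine (MvPolynomial.totalDegree_add _ _).trans (max_le ?_ (by rw [MvPolynomial.totalDegree_C]; omega))
  exact MvPolynomial.totalDegree_finsetSum_le fun i _ => by simp

lemma polyFun_mul {d : ℕ} (p q : MvPolynomial (Fin d) ℝ) (z : Euc d) :
    polyFun (p * q) z = polyFun p z * polyFun q z := by simp [polyFun]

lemma eq_zero_of_polyFun_eq_zero {d : ℕ} {t : ℝ} (ht : 0 < t) {p : MvPolynomial (Fin d) ℝ}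
    (hp : ∀ z ∈ ball (0 : Euc d) t, polyFun p z = 0) : p = 0 := by
  obtain ⟨s, hs, hsb⟩ : ∃ s > 0, ∀ x : Fin d → ℝ, (∀ i, x i ∈ Ioo (-s) s) →
      WithLp.toLp 2 x ∈ ball (0 : Euc d) t := by
    have hc : Continuous (fun x : Fin d → ℝ => (WithLp.toLp 2 x : Euc d)) := by fun_prop
    have := hc.continuousAt (x := 0) (ball_mem_nhds (0 : Euc d) ht)
    obtain ⟨s, hs, h⟩ := Metric.mem_nhds_iff.1 this
    refine ⟨s, hs, fun x hx => h ?_⟩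
    rw [mem_ball, dist_pi_lt_iff hs]
    intro i
    simpa [abs_lt] using hx i
  refine MvPolynomial.funext_set (fun _ => Ioo (-s) s)
    (fun _ => Ioo_infinite (by linarith)) fun x hx => ?_
  have := hp _ (hsb x fun i => hx i (mem_univ i))
  simpa [polyFun] using this

/-- The Dirichlet problem on a ball with polynomial boundary values. -/
lemma exists_polyLaplacian_eq_zero_eqOn_sphere {d : ℕ} [NeZero d] {t : ℝ} (ht : 0 < t)
    (q : MvPolynomial (Fin d) ℝ) : ∃ h : MvPolynomial (Fin d) ℝ, polyLaplacian d h = 0 ∧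
      ∀ z ∈ sphere (0 : Euc d) t, polyFun h z = polyFun q z := by
  set n := q.totalDegree
  let M := MvPolynomial.restrictTotalDegree (Fin d) ℝ n
  let L₀ : MvPolynomial (Fin d) ℝ →ₗ[ℝ] MvPolynomial (Fin d) ℝ :=
    polyLaplacian d ∘ₗ LinearMap.mulLeft ℝ (sphPoly d t)
  have hL₀ : ∀ p ∈ M, L₀ p ∈ M := by
    intro p hp
    rw [MvPolynomial.mem_restrictTotalDegree] at hp ⊢
    refine totalDegree_polyLaplacian_le ((MvPolynomial.totalDegree_mul _ _).trans ?_)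
    have := totalDegree_sphPoly_le d t
    omega
  let L : M →ₗ[ℝ] M := L₀.restrict hL₀
  have hinj : Function.Injective L := by
    rw [← LinearMap.ker_eq_bot, LinearMap.ker_eq_bot']
    intro p hp
    have h0 : polyLaplacian d (sphPoly d t * p.1) = 0 := congrArg Subtype.val hp
    have hh := harmOn_polyFun h0 univ
    have hs : ∀ z ∈ sphere (0 : Euc d) t, polyFun (sphPoly d t * p.1) z = 0 := by
      intro z hz
      rw [polyFun_mul, polyFun_sphPoly, mem_sphere_zero_iff_norm.1 hz]; ring
    have hle := ((hh.mono (subset_univ (ball 0 t))).locSub isOpen_ball).le_of_le_sphere ht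
      (continuous_polyFun _).continuousOn (B := 0) (fun z hz => (hs z hz).le)
    have hge := ((hh.neg.mono (subset_univ (ball 0 t))).locSub isOpen_ball).le_of_le_sphere ht
      (continuous_polyFun _).neg.continuousOn (B := 0) (fun z hz => by simp [hs z hz])
    refine Subtype.ext (eq_zero_of_polyFun_eq_zero ht fun z hz => ?_)
    have h1 := hle z (ball_subset_closedBall hz)
    have h2 := hge z (ball_subset_closedBall hz)
    have h3 : polyFun (sphPoly d t * p.1) z = 0 := by linarith
    rw [polyFun_mul, polyFun_sphPoly] at h3
    have h4 : ‖z‖ < t := by simpa using hz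
    rcases mul_eq_zero.1 h3 with h | h
    · nlinarith [norm_nonneg z]
    · exact h
  have hΔq : polyLaplacian d q ∈ M := by
    rw [MvPolynomial.mem_restrictTotalDegree]
    exact totalDegree_polyLaplacian_le (by omega)
  obtain ⟨p, hp⟩ := LinearMap.injective_iff_surjective.1 hinj ⟨_, hΔq⟩
  have hp' : polyLaplacian d (sphPoly d t * p.1) = polyLaplacian d q := congrArg Subtype.val hp
  refine ⟨q - sphPoly d t * p.1, by rw [map_sub, hp', sub_self], fun z hz => ?_⟩
  have : polyFun (q - sphPoly d t * p.1) z = polyFun q z - polyFun (sphPoly d t * p.1) z := by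
    simp [polyFun]
  rw [this, polyFun_mul, polyFun_sphPoly, mem_sphere_zero_iff_norm.1 hz]; ring

/-- Polynomials are uniformly dense in the continuous functions on a sphere. -/
lemma exists_polyFun_near {d : ℕ} {g : Euc d → ℝ} (hg : Continuous g) (t : ℝ) {η : ℝ}
    (hη : 0 < η) : ∃ q : MvPolynomial (Fin d) ℝ,
      ∀ z ∈ sphere (0 : Euc d) t, |polyFun q z - g z| < η := by
  let K := sphere (0 : Euc d) t
  have : CompactSpace K := isCompact_iff_compactSpace.1 (isCompact_sphere 0 t)
  let Φ : MvPolynomial (Fin d) ℝ →ₐ[ℝ] C(K, ℝ) :=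
    MvPolynomial.aeval fun i => ⟨fun z : K => (z : Euc d) i, by fun_prop⟩
  have hΦ : ∀ p (z : K), Φ p z = polyFun p z := by
    intro p z
    induction p using MvPolynomial.induction_on with
    | C a => simp [Φ, polyFun]
    | add p q hp hq => simp [polyFun] at hp hq ⊢; rw [hp, hq]
    | mul_X p j hp => simp [polyFun] at hp ⊢; rw [hp]; simp [Φ]
  have hsep : Φ.range.SeparatesPoints := by
    intro x y hxy
    obtain ⟨i, hi⟩ : ∃ i, (x : Euc d) i ≠ (y : Euc d) i := by
      by_contra! hcon
      exact hxy (Subtype.ext (PiLp.ext hcon))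
    exact ⟨Φ (MvPolynomial.X i), ⟨Φ (MvPolynomial.X i), ⟨MvPolynomial.X i, rfl⟩, rfl⟩, by
      simpa [hΦ, polyFun] using hi⟩
  obtain ⟨⟨_, q, rfl⟩, hq⟩ := ContinuousMap.exists_mem_subalgebra_near_continuousMap_of_separatesPoints
    Φ.range hsep ⟨fun z : K => g z, by fun_prop⟩ η hη
  refine ⟨q, fun z hz => ?_⟩
  have := (ContinuousMap.norm_coe_le_norm _ (⟨z, hz⟩ : K)).trans_lt hq
  have h2 := hΦ q ⟨z, hz⟩
  rw [← h2]
  simpa using this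

/-- Surface measure on the unit sphere. -/
abbrev sphMeas (d : ℕ) : Measure (sphere (0 : Euc d) 1) := (volume : Measure (Euc d)).toSphere

/-- The radial measure in polar coordinates. -/
abbrev radMeas (d : ℕ) : Measure (Ioi (0 : ℝ)) :=
  Measure.volumeIoiPow (Module.finrank ℝ (Euc d) - 1)

lemma integrable_polar {d : ℕ} {f : Euc d → ℝ} (hf : Integrable f) :
    Integrable (fun p : sphere (0 : Euc d) 1 × Ioi (0 : ℝ) => f (p.2.1 • p.1.1))
      ((sphMeas d).prod (radMeas d)) := by
  have h := (volume : Measure (Euc d)).measurePreserving_homeomorphUnitSphereProd.symm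
    (homeomorphUnitSphereProd (Euc d)).toMeasurableEquiv
  have h1 : Integrable (fun x : ({(0 : Euc d)}ᶜ : Set (Euc d)) => f x)
      ((volume : Measure (Euc d)).comap (↑)) := by
    have := (integrableOn_iff_comap_subtypeVal (f := f) (μ := volume)
      (measurableSet_singleton (0 : Euc d)).compl).1 hf.integrableOn
    exact this
  have h2 := h.integrable_comp_of_integrable h1
  refine h2.congr (Eventually.of_forall fun p => ?_)
  simp [Homeomorph.toMeasurableEquiv]

lemma integral_polar {d : ℕ} [NeZero d] {f : Euc d → ℝ} (hf : Integrable f) :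
    ∫ z, f z = ∫ t : Ioi (0 : ℝ), ∫ θ, f (t.1 • θ.1) ∂(sphMeas d) ∂(radMeas d) := by
  have hp := integrable_polar hf
  calc
    ∫ z, f z = ∫ x : ({(0 : Euc d)}ᶜ : Set (Euc d)), f x ∂((volume : Measure (Euc d)).comap (↑)) := by
      have : Nontrivial (Euc d) := by
        apply Module.nontrivial_of_finrank_pos (R := ℝ)
        rw [finrank_euclideanSpace_fin]; exact NeZero.pos d
      rw [integral_subtype_comap (measurableSet_singleton _).compl fun x ↦ f x,
        restrict_compl_singleton]
    _ = ∫ p : sphere (0 : Euc d) 1 × Ioi (0 : ℝ), f (p.2.1 • p.1.1)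
        ∂((sphMeas d).prod (radMeas d)) := by
      rw [← (volume : Measure (Euc d)).measurePreserving_homeomorphUnitSphereProd.integral_comp
        (Homeomorph.measurableEmbedding _)]
      refine integral_congr_ae (Eventually.of_forall fun x => ?_)
      have : ‖(x : Euc d)‖ ≠ 0 := norm_ne_zero_iff.2 x.2
      simp [smul_smul, this]
    _ = _ := integral_prod_symm _ hp

lemma integral_radMeas {d : ℕ} [NeZero d] (g : ℝ → ℝ) :
    ∫ t : Ioi (0 : ℝ), g t ∂(radMeas d) = ∫ t in Ioi (0 : ℝ), t ^ (d - 1) * g t := by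
  simp only [radMeas, Measure.volumeIoiPow, ENNReal.ofReal]
  rw [integral_withDensity_eq_integral_smul, ← integral_subtype_comap measurableSet_Ioi
    fun a => a ^ (d - 1) * g a]
  · refine integral_congr_ae (Eventually.of_forall fun t => ?_)
    have : 0 ≤ t.1 ^ (d - 1) := pow_nonneg (le_of_lt t.2) _
    simp [NNReal.smul_def, Real.coe_toNNReal _ this]
  · fun_prop

lemma continuous_sphMean {d : ℕ} {f : Euc d → ℝ} (hf : Continuous f) :
    Continuous fun t : ℝ => ∫ θ, f (t • θ.1) ∂(sphMeas d) := by
  have h := continuous_parametric_integral_of_continuous (μ := sphMeas d)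
    (f := fun (t : ℝ) (θ : sphere (0 : Euc d) 1) => f (t • θ.1))
    (by simp only [Function.uncurry_def]; fun_prop) isCompact_univ
  simpa using h

lemma HarmOn.sphMean_eq {d : ℕ} [NeZero d] {f : Euc d → ℝ} (hf : HarmOn f univ) {t : ℝ}
    (ht : 0 < t) : ∫ θ, f (t • θ.1) ∂(sphMeas d) = f 0 * (sphMeas d).real univ := by
  have hfc : Continuous f := continuousOn_univ.1 hf.1
  set g : Euc d → ℝ := fun z => f z - f 0 with hg
  have hgc : Continuous g := by fun_prop
  set G : ℝ → ℝ := fun t => ∫ θ, g (t • θ.1) ∂(sphMeas d) with hG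
  have hGc : Continuous G := continuous_sphMean hgc
  have hint : ∀ R : ℝ, 0 < R → ∫ s in (0:ℝ)..R, s ^ (d - 1) * G s = 0 := by
    intro R hR
    have h1 : ∫ z in closedBall (0 : Euc d) R, g z = 0 := by
      have := (hf.add_const (- f 0)).integral_eq (x := 0) hR (subset_univ _)
      simpa [hg, sub_eq_add_neg] using this
    have hgi := hgc.continuousOn.integrableOn_compact (μ := volume) (isCompact_closedBall (0 : Euc d) R)
    rw [← integral_indicator isClosed_closedBall.measurableSet, integral_polar
      ((integrable_indicator_iff isClosed_closedBall.measurableSet).2 hgi)] at h1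
    have h2 : ∀ s : Ioi (0 : ℝ), ∫ θ, (closedBall (0 : Euc d) R).indicator g (s.1 • θ.1) ∂(sphMeas d)
        = (Iic R).indicator G s.1 := by
      intro s
      have hs : (0:ℝ) < s.1 := s.2
      have hn : ∀ θ : sphere (0 : Euc d) 1, ‖s.1 • θ.1‖ = s.1 := fun θ => by
        rw [norm_smul, mem_sphere_zero_iff_norm.1 θ.2, mul_one, Real.norm_of_nonneg hs.le]
      by_cases h : s.1 ≤ R
      · rw [indicator_of_mem (show s.1 ∈ Iic R from h)]
        refine integral_congr_ae (Eventually.of_forall fun θ => ?_)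
        exact indicator_of_mem (by rw [mem_closedBall_zero_iff, hn]; exact h) _
      · rw [indicator_of_notMem (show s.1 ∉ Iic R from h)]
        rw [integral_eq_zero_of_ae (Eventually.of_forall fun θ => ?_)]
        exact indicator_of_notMem (by rw [mem_closedBall_zero_iff, hn]; exact h) _
    simp only [h2] at h1
    rw [integral_radMeas] at h1
    rw [intervalIntegral.integral_of_le hR.le, ← Ioi_inter_Iic,
      ← setIntegral_indicator measurableSet_Iic]
    refine Eq.trans ?_ h1
    refine integral_congr_ae (Eventually.of_forall fun s => ?_)
    by_cases h : s ∈ Iic R <;> simp [h]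
  have hcont : Continuous fun s : ℝ => s ^ (d - 1) * G s := by fun_prop
  have hd1 := (hcont.integral_hasStrictDerivAt 0 t).hasDerivAt
  have hd2 : HasDerivAt (fun R => ∫ s in (0:ℝ)..R, s ^ (d - 1) * G s) 0 t := by
    refine (hasDerivAt_const t (0:ℝ)).congr_of_eventuallyEq ?_
    filter_upwards [lt_mem_nhds ht] with R hR using hint R hR
  have h3 : t ^ (d - 1) * G t = 0 := hd1.unique hd2
  have h4 : G t = 0 := (mul_eq_zero.1 h3).resolve_left (by positivity)
  have hfi : Integrable (fun θ : sphere (0 : Euc d) 1 => f (t • θ.1)) (sphMeas d) :=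
    (show Continuous fun θ : sphere (0 : Euc d) 1 => f (t • θ.1) by fun_prop).integrable_of_hasCompactSupport
      (HasCompactSupport.of_compactSpace _)
  simp only [hG, hg] at h4
  rw [integral_sub hfi (integrable_const _), integral_const, smul_eq_mul] at h4
  linarith

/-- A bounded upper semicontinuous function is a pointwise limit of continuous majorants. -/
lemma UpperSemicontinuousOn.exists_continuous_tendsto {X : Type*} [PseudoMetricSpace X] {K : Set X}
    {u : X → ℝ} {M : ℝ} (hu : UpperSemicontinuousOn u K) (hM : ∀ x ∈ K, |u x| ≤ M) :
    ∃ g : ℕ → X → ℝ, (∀ k, Continuous (g k)) ∧ (∀ k, ∀ x ∈ K, u x ≤ g k x ∧ g k x ≤ M) ∧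
      ∀ x ∈ K, Tendsto (fun k => g k x) atTop (𝓝 (u x)) := by
  rcases K.eq_empty_or_nonempty with rfl | hne
  · exact ⟨fun _ _ => 0, fun _ => continuous_const, by simp, by simp⟩
  have : Nonempty K := hne.to_subtype
  have hb : ∀ (k : ℕ) (x : X) (w : K), u w - k * dist x w ≤ M := fun k x w => by
    have h1 := (abs_le.1 (hM w w.2)).2
    have h2 : 0 ≤ (k : ℝ) * dist x w := by positivity
    linarith
  have hbdd : ∀ (k : ℕ) (x : X), BddAbove (range fun w : K => u w - k * dist x w) := fun k x =>
    ⟨M, by rintro _ ⟨w, rfl⟩; exact hb k x w⟩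
  have hle : ∀ (k : ℕ), ∀ x ∈ K, u x ≤ ⨆ w : K, (u w - k * dist x w) := fun k x hx => by
    have := le_ciSup (hbdd k x) ⟨x, hx⟩
    simpa using this
  refine ⟨fun k x => ⨆ w : K, (u w - k * dist x w), fun k => ?_, fun k x hx => ?_, fun x hx => ?_⟩
  · refine (LipschitzWith.of_le_add_mul (k : NNReal) fun x y => ?_).continuous
    refine ciSup_le fun w => ?_
    have h1 := le_ciSup (hbdd k y) w
    have h2 : (k : ℝ) * dist y w ≤ k * (dist x y + dist x w) := by
      gcongr; rw [dist_comm x y]; exact dist_triangle y x w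
    simp only [NNReal.coe_natCast] at h1 ⊢
    linarith
  · exact ⟨hle k x hx, ciSup_le fun w => hb k x w⟩
  · rw [Metric.tendsto_atTop]
    intro η hη
    have h1 := hu x hx (u x + η / 2) (by linarith)
    obtain ⟨r, hr, hr'⟩ := Metric.mem_nhdsWithin_iff.1 h1
    obtain ⟨k₀, hk₀⟩ := exists_nat_gt ((M - u x) / r)
    refine ⟨k₀, fun k hk => ?_⟩
    have hkk : (k₀ : ℝ) ≤ k := by exact_mod_cast hk
    have h2 : (⨆ w : K, (u w - k * dist x w)) ≤ u x + η / 2 := by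
      refine ciSup_le fun w => ?_
      by_cases hw : dist (w : X) x < r
      · have h3 : u w < u x + η / 2 := hr' ⟨hw, w.2⟩
        have h4 : 0 ≤ (k : ℝ) * dist x w := by positivity
        linarith
      · rw [not_lt, dist_comm] at hw
        have h3 := (abs_le.1 (hM w w.2)).2
        have h5 : (M - u x) / r < k := hk₀.trans_le hkk
        rw [div_lt_iff₀ hr] at h5
        have h4 : (k : ℝ) * r ≤ k * dist x w := by gcongr
        linarith
    have h3 := hle k x hx
    rw [Real.dist_eq, abs_lt]
    constructor <;> linarith

lemma SbhOn.upperSemicontinuousOn_real {d : ℕ} {u : Euc d → ℝ} {V : Set (Euc d)}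
    (hu : SbhOn (fun x => (u x : EReal)) V) : UpperSemicontinuousOn u V := by
  intro x hx b hb
  filter_upwards [hu.1 x hx b (EReal.coe_lt_coe_iff.2 hb)] with y hy
  exact EReal.coe_lt_coe_iff.1 hy

/-- The mean value inequality over spheres. -/
lemma SbhOn.le_sphMean {d : ℕ} [NeZero d] {u : Euc d → ℝ} {V : Set (Euc d)}
    (hu : SbhOn (fun x => (u x : EReal)) V) {y : Euc d} {t M : ℝ} (ht : 0 < t)
    (hV : closedBall y t ⊆ V) (hM : ∀ z ∈ closedBall y t, |u z| ≤ M) :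
    u y * (sphMeas d).real univ ≤ ∫ θ, u (y + t • θ.1) ∂(sphMeas d) := by
  have hmem : ∀ θ : sphere (0 : Euc d) 1, t • θ.1 ∈ sphere (0 : Euc d) t := fun θ => by
    rw [mem_sphere_zero_iff_norm, norm_smul, mem_sphere_zero_iff_norm.1 θ.2, mul_one,
      Real.norm_of_nonneg ht.le]
  have hmem' : ∀ θ : sphere (0 : Euc d) 1, y + t • θ.1 ∈ closedBall y t := fun θ => by
    have := mem_sphere_zero_iff_norm.1 (hmem θ)
    rw [mem_closedBall, dist_eq_norm, add_sub_cancel_left, this]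
  have hcint : ∀ g : Euc d → ℝ, Continuous g →
      Integrable (fun θ : sphere (0 : Euc d) 1 => g (t • θ.1)) (sphMeas d) := fun g hg =>
    (show Continuous fun θ : sphere (0 : Euc d) 1 => g (t • θ.1) by
      fun_prop).integrable_of_hasCompactSupport (HasCompactSupport.of_compactSpace _)
  have hcont : ∀ g : Euc d → ℝ, Continuous g → (∀ z ∈ sphere (0 : Euc d) t, u (y + z) ≤ g z) →
      u y * (sphMeas d).real univ ≤ ∫ θ, g (t • θ.1) ∂(sphMeas d) := by
    intro g hg hug
    refine le_of_forall_pos_le_add fun η hη => ?_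
    set σ := (sphMeas d).real univ
    have hσ : 0 ≤ σ := measureReal_nonneg
    set η' := η / (2 * (σ + 1)) with hη'
    have hη'0 : 0 < η' := by positivity
    obtain ⟨q, hq⟩ := exists_polyFun_near hg t hη'0
    obtain ⟨h, hh0, hhq⟩ := exists_polyLaplacian_eq_zero_eqOn_sphere ht q
    have hh := harmOn_polyFun hh0 univ
    have hH : HarmOn (fun z => polyFun h (z - y) + η') univ := by
      simpa using (hh.comp_sub y).add_const η'
    have h1 : u y ≤ polyFun h 0 + η' := by
      have := hu.2.2 y t ht hV _ (hH.1.mono (subset_univ _)) (hH.mono (subset_univ _))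
        (fun z hz => ?_) y (mem_closedBall_self ht.le)
      · simpa using EReal.coe_le_coe_iff.1 this
      · have hz' : z - y ∈ sphere (0 : Euc d) t := by
          rw [mem_sphere_zero_iff_norm, ← dist_eq_norm]; exact hz
        have h2 := hug _ hz'
        rw [add_sub_cancel] at h2
        have h3 := (abs_lt.1 (hq _ hz')).1
        rw [EReal.coe_le_coe_iff, hhq _ hz']
        linarith
    have h2 := hh.sphMean_eq ht
    have h3 : ∫ θ, polyFun h (t • θ.1) ∂(sphMeas d) ≤ ∫ θ, (g (t • θ.1) + η') ∂(sphMeas d) := by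
      refine integral_mono (hcint _ (continuous_polyFun h)) ((hcint g hg).add (integrable_const _))
        fun θ => ?_
      have := (abs_lt.1 (hq _ (hmem θ))).2
      simp only
      rw [hhq _ (hmem θ)]
      linarith
    rw [integral_add (hcint g hg) (integrable_const _), integral_const, smul_eq_mul, h2] at h3
    have h4 : u y * σ ≤ (polyFun h 0 + η') * σ := by gcongr
    have h5 : 2 * (σ * η') ≤ η := by
      rw [hη', mul_div_assoc', mul_div_assoc', div_le_iff₀ (by positivity)]
      nlinarith
    change _ ≤ _ + σ * η' at h3
    linarith
  have husc : UpperSemicontinuousOn (fun z => u (y + z)) (sphere (0 : Euc d) t) := by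
    have hmaps : MapsTo (fun z => y + z) (sphere (0 : Euc d) t) V := fun z hz => hV (by
      rw [mem_closedBall, dist_eq_norm, add_sub_cancel_left, mem_sphere_zero_iff_norm.1 hz])
    exact hu.upperSemicontinuousOn_real.comp (by fun_prop) hmaps
  obtain ⟨g, hgc, hgb, hgt⟩ := husc.exists_continuous_tendsto (M := M) fun z hz => hM _ (by
    rw [mem_closedBall, dist_eq_norm, add_sub_cancel_left, mem_sphere_zero_iff_norm.1 hz])
  have hlim : Tendsto (fun k => ∫ θ, g k (t • θ.1) ∂(sphMeas d)) atTop
      (𝓝 (∫ θ, u (y + t • θ.1) ∂(sphMeas d))) := by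
    refine tendsto_integral_of_dominated_convergence (fun _ => M)
      (fun k => (hcint _ (hgc k)).aestronglyMeasurable) (integrable_const _)
      (fun k => Eventually.of_forall fun θ => ?_) (Eventually.of_forall fun θ => hgt _ (hmem θ))
    have h1 := hgb k _ (hmem θ)
    have h2 := (abs_le.1 (hM _ (hmem' θ))).1
    exact abs_le.2 ⟨by linarith, h1.2⟩
  exact ge_of_tendsto' hlim fun k => hcont _ (hgc k) fun z hz => (hgb k z hz).1

lemma UpperSemicontinuousOn.measurable_indicator {d : ℕ} {u : Euc d → ℝ} {V : Set (Euc d)}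
    (hu : UpperSemicontinuousOn u V) (hV : IsOpen V) : Measurable (V.indicator u) := by
  refine measurable_of_Iio fun b => ?_
  have h : IsOpen (V ∩ {x | u x < b}) := by
    rw [isOpen_iff_mem_nhds]
    rintro x ⟨hx, hxb⟩
    have := hu x hx b hxb
    rw [hV.nhdsWithin_eq hx] at this
    exact inter_mem (hV.mem_nhds hx) this
  have h2 : V.indicator u ⁻¹' Iio b = (V ∩ {x | u x < b}) ∪ (Vᶜ ∩ {_x | (0 : ℝ) < b}) := by
    ext x
    by_cases hx : x ∈ V <;> simp [hx]
  rw [h2]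
  exact h.measurableSet.union (hV.measurableSet.compl.inter (MeasurableSet.const _))

/-- The mean value inequality with a radial weight supported in a ball. -/
lemma SbhOn.mul_integral_le {d : ℕ} [NeZero d] {u : Euc d → ℝ} {V : Set (Euc d)}
    (hu : SbhOn (fun x => (u x : EReal)) V) (hVo : IsOpen V) {y : Euc d} {R M : ℝ}
    (hV : closedBall y R ⊆ V) (hM : ∀ z ∈ closedBall y R, |u z| ≤ M)
    {ψ : Euc d → ℝ} (hψ : Integrable ψ) (hψ0 : ∀ z, 0 ≤ ψ z) (hψR : ∀ z, R < ‖z‖ → ψ z = 0)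
    (hψr : ∀ z w, ‖z‖ = ‖w‖ → ψ z = ψ w) :
    Integrable (fun z => ψ z * u (y + z)) ∧ u y * ∫ z, ψ z ≤ ∫ z, ψ z * u (y + z) := by
  have hform : (fun z => ψ z * u (y + z)) = fun z => ψ z *
      (closedBall (0 : Euc d) R).indicator (fun z => V.indicator u (y + z)) z := by
    ext z
    by_cases hz : ‖z‖ ≤ R
    · rw [indicator_of_mem (by simpa using hz), indicator_of_mem (hV (by simpa using hz))]
    · simp [hψR z (not_le.1 hz)]
  have hmeas : Measurable fun z => V.indicator u (y + z) :=
    (hu.upperSemicontinuousOn_real.measurable_indicator hVo).comp (by fun_prop)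
  have hi : Integrable (fun z => ψ z * u (y + z)) := by
    rw [hform]
    refine hψ.mul_bdd (c := |M|)
      (hmeas.indicator isClosed_closedBall.measurableSet).aestronglyMeasurable
      (Eventually.of_forall fun z => ?_)
    by_cases hz : ‖z‖ ≤ R
    · rw [indicator_of_mem (by simpa using hz), indicator_of_mem (hV (by simpa using hz))]
      exact (hM _ (by simpa using hz)).trans (le_abs_self M)
    · rw [indicator_of_notMem (by simpa using hz)]; simp
  refine ⟨hi, ?_⟩
  have hd : ∫ z, (ψ z * u (y + z) - u y * ψ z) =
      (∫ z, ψ z * u (y + z)) - u y * ∫ z, ψ z := by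
    rw [integral_sub hi (hψ.const_mul _), integral_const_mul]
  rw [← sub_nonneg, ← hd, integral_polar (f := fun z => ψ z * u (y + z) - u y * ψ z)
    (hi.sub (hψ.const_mul _))]
  refine integral_nonneg fun t => ?_
  have ht : (0 : ℝ) < t.1 := t.2
  have hn : ∀ θ : sphere (0 : Euc d) 1, ‖t.1 • θ.1‖ = t.1 := fun θ => by
    rw [norm_smul, mem_sphere_zero_iff_norm.1 θ.2, mul_one, Real.norm_of_nonneg ht.le]
  by_cases htR : t.1 ≤ R
  · have hsub : closedBall y t.1 ⊆ closedBall y R := closedBall_subset_closedBall htR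
    have hmean := hu.le_sphMean ht (hsub.trans hV) fun z hz => hM z (hsub hz)
    rcases isEmpty_or_nonempty (sphere (0 : Euc d) 1) with he | ⟨⟨θ₀⟩⟩
    · rw [Measure.eq_zero_of_isEmpty (sphMeas d)]; simp
    set c := ψ (t.1 • θ₀.1) with hc
    have hc0 : 0 ≤ c := hψ0 _
    have h1 : ∀ θ : sphere (0 : Euc d) 1, ψ (t.1 • θ.1) = c := fun θ =>
      hψr _ _ (by rw [hn, hn])
    have hmem : ∀ θ : sphere (0 : Euc d) 1, y + t.1 • θ.1 ∈ closedBall y R := fun θ => by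
      rw [mem_closedBall, dist_eq_norm, add_sub_cancel_left, hn]; exact htR
    have hui : Integrable (fun θ : sphere (0 : Euc d) 1 => u (y + t.1 • θ.1)) (sphMeas d) := by
      have h2 : (fun θ : sphere (0 : Euc d) 1 => u (y + t.1 • θ.1)) =
          fun θ => V.indicator u (y + t.1 • θ.1) := by
        ext θ; rw [indicator_of_mem (hV (hmem θ))]
      have h3 : Measurable (fun θ : sphere (0 : Euc d) 1 => u (y + t.1 • θ.1)) := by
        rw [h2]
        exact (hu.upperSemicontinuousOn_real.measurable_indicator hVo).comp (by fun_prop)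
      exact Integrable.of_bound h3.aestronglyMeasurable M
        (Eventually.of_forall fun θ => hM _ (hmem θ))
    have h4 : ∫ θ, (ψ (t.1 • θ.1) * u (y + t.1 • θ.1) - u y * ψ (t.1 • θ.1)) ∂(sphMeas d) =
        c * ((∫ θ, u (y + t.1 • θ.1) ∂(sphMeas d)) - u y * (sphMeas d).real univ) := by
      simp only [h1]
      rw [integral_sub (hui.const_mul _) (integrable_const _), integral_const_mul, integral_const,
        smul_eq_mul]
      ring
    simp only [Pi.zero_apply]
    rw [h4]
    exact mul_nonneg hc0 (sub_nonneg.2 hmean)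
  · refine (integral_eq_zero_of_ae (Eventually.of_forall fun θ => ?_)).ge
    have := hψR (t.1 • θ.1) (by rw [hn]; exact not_le.1 htR)
    simp [this]

lemma setIntegral_comp_isometry {d : ℕ} (T : Euc d ≃ₗᵢ[ℝ] Euc d) (f : Euc d → ℝ) {K : Set (Euc d)}
    (hK : ∀ z, T z ∈ K ↔ z ∈ K) : ∫ z in K, f (T z) = ∫ z in K, f z := by
  have h := T.measurePreserving.setIntegral_preimage_emb
    T.toHomeomorph.measurableEmbedding f K
  have h2 : T ⁻¹' K = K := by ext z; exact hK z
  rwa [h2] at h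

lemma exists_isometry_of_norm_eq {d : ℕ} {z w : Euc d} (h : ‖z‖ = ‖w‖) :
    ∃ T : Euc d ≃ₗᵢ[ℝ] Euc d, T z = w :=
  ⟨(ℝ ∙ (z - w))ᗮ.reflection, Submodule.reflection_sub h⟩

lemma closedBall_integral_radial {d : ℕ} (ε : ℝ) {K : Set (Euc d)}
    (hK : ∀ (T : Euc d ≃ₗᵢ[ℝ] Euc d) (z : Euc d), T z ∈ K ↔ z ∈ K)
    {z w : Euc d} (h : ‖z‖ = ‖w‖) :
    ∫ x in K, regSol d ε (x - z) = ∫ x in K, regSol d ε (x - w) := by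
  obtain ⟨T, hT⟩ := exists_isometry_of_norm_eq h
  rw [← setIntegral_comp_isometry T (fun x => regSol d ε (x - w)) (hK T)]
  refine integral_congr_ae (Eventually.of_forall fun x => ?_)
  refine regSol_eq_of_norm_eq ε ?_
  rw [← hT, ← map_sub, T.norm_map]

/-- The difference between a ball integral of `regSol` and the corresponding multiple of its
central value. -/
def ballKer (d : ℕ) (ε : ℝ) (z : Euc d) : ℝ :=
  (∫ x in closedBall (0 : Euc d) (2 * ε), regSol d ε (x - z)) -
    volume.real (closedBall (0 : Euc d) (2 * ε)) * regSol d ε z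

lemma continuous_setIntegral_regSol {d : ℕ} {ε : ℝ} (hε : 0 < ε) (μ : Measure (Euc d))
    [IsFiniteMeasureOnCompacts μ] {K : Set (Euc d)} (hK : IsCompact K) :
    Continuous fun z => ∫ x in K, regSol d ε (x - z) ∂μ := by
  have hc := continuous_regSol d hε
  exact continuous_parametric_integral_of_continuous (μ := μ)
    (f := fun (z x : Euc d) => regSol d ε (x - z))
    (by simp only [Function.uncurry_def]; fun_prop) hK

lemma continuous_ballKer {d : ℕ} {ε : ℝ} (hε : 0 < ε) : Continuous (ballKer d ε) :=
  (continuous_setIntegral_regSol hε volume (isCompact_closedBall _ _)).sub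
    (continuous_const.mul (continuous_regSol d hε))

lemma ballKer_eq_of_norm_eq {d : ℕ} (ε : ℝ) {z w : Euc d} (h : ‖z‖ = ‖w‖) :
    ballKer d ε z = ballKer d ε w := by
  rw [ballKer, ballKer, regSol_eq_of_norm_eq ε h,
    closedBall_integral_radial ε (fun T z => by simp) h]

lemma ballKer_neg {d : ℕ} (ε : ℝ) (z : Euc d) : ballKer d ε (-z) = ballKer d ε z :=
  ballKer_eq_of_norm_eq ε (norm_neg z)

lemma ballKer_eq {d : ℕ} (ε : ℝ) (z : Euc d) :
    ballKer d ε z = (∫ x in closedBall z (2 * ε), regSol d ε x) -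
      volume.real (closedBall (0 : Euc d) (2 * ε)) * regSol d ε z := by
  rw [← ballKer_neg, ballKer, setIntegral_closedBall_sub, regSol_neg]
  simp

lemma volume_real_closedBall_center {d : ℕ} (x : Euc d) (r : ℝ) :
    volume.real (closedBall x r) = volume.real (closedBall (0 : Euc d) r) := by
  rw [← volume_real_closedBall_sub x x r, sub_self]

/-- The mean value inequality over balls. -/
lemma SbhOn.mul_volume_le {d : ℕ} [NeZero d] {u : Euc d → ℝ} {V : Set (Euc d)}
    (hu : SbhOn (fun x => (u x : EReal)) V) (hVo : IsOpen V) {y : Euc d} {r M : ℝ}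
    (hV : closedBall y r ⊆ V) (hM : ∀ z ∈ closedBall y r, |u z| ≤ M) :
    u y * volume.real (closedBall y r) ≤ ∫ z in closedBall y r, u z := by
  have h1 : Integrable ((closedBall (0 : Euc d) r).indicator (fun _ => (1 : ℝ))) :=
    (integrable_indicator_iff isClosed_closedBall.measurableSet).2
      (continuousOn_const.integrableOn_compact (isCompact_closedBall _ _))
  have h2 := (hu.mul_integral_le hVo hV hM h1 (fun z => indicator_nonneg (by simp) z)
    (fun z hz => indicator_of_notMem (by simpa using hz) _)
    (fun z w h => by simp only [indicator, mem_closedBall_zero_iff, h])).2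
  rw [integral_indicator isClosed_closedBall.measurableSet, setIntegral_const, smul_eq_mul,
    mul_one, ← volume_real_closedBall_center y] at h2
  refine h2.trans_eq ?_
  have h3 := setIntegral_closedBall_sub u (-y) 0 r
  rw [zero_sub, neg_neg] at h3
  rw [← h3, ← integral_indicator isClosed_closedBall.measurableSet]
  refine integral_congr_ae (Eventually.of_forall fun z => ?_)
  by_cases hz : z ∈ closedBall (0 : Euc d) r
  · simp only [indicator_of_mem hz, one_mul, sub_neg_eq_add, add_comm]
  · simp only [indicator_of_notMem hz, zero_mul]

lemma ballKer_nonneg {d : ℕ} [NeZero d] {ε : ℝ} (hε : 0 < ε) (z : Euc d) :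
    0 ≤ ballKer d ε z := by
  have hs : SbhOn (fun y => (regSol d ε y : EReal)) univ := by
    simpa using sbhOn_regSol (d := d) hε 0 univ
  obtain ⟨M, hM⟩ := (isCompact_closedBall z (2 * ε)).exists_bound_of_continuousOn
    (continuous_regSol d hε).continuousOn
  have := hs.mul_volume_le isOpen_univ (subset_univ _) hM
  rw [volume_real_closedBall_center] at this
  rw [ballKer_eq]
  linarith

lemma ballKer_eq_zero {d : ℕ} [NeZero d] {ε : ℝ} (hε : 0 < ε) {z : Euc d} (hz : 3 * ε < ‖z‖) :
    ballKer d ε z = 0 := by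
  have hge : ∀ x ∈ closedBall z (2 * ε), ε ≤ ‖x‖ := fun x hx => by
    rw [mem_closedBall, dist_eq_norm] at hx
    have := norm_sub_norm_le z x
    rw [norm_sub_rev] at this
    linarith
  have h1 : ∫ x in closedBall z (2 * ε), regSol d ε x = ∫ x in closedBall z (2 * ε), fundSol d x :=
    setIntegral_congr_fun isClosed_closedBall.measurableSet
      fun x hx => regSol_eq_fundSol hε (hge x hx)
  rw [ballKer_eq, h1, (harmOn_fundSol d).integral_eq (by positivity), regSol_eq_fundSol hε
    (by linarith), volume_real_closedBall_center z]
  · ring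
  · intro x hx
    have := hge x hx
    exact norm_pos_iff.1 (hε.trans_le this)

lemma ballKer_zero_ne {d : ℕ} [NeZero d] {ε : ℝ} (hε : 0 < ε) : ballKer d ε 0 ≠ 0 := by
  intro h
  rw [ballKer_eq, sub_eq_zero] at h
  have h1 := eq_on_ball_of_le_of_mean_ge (f := fun z => - regSol d ε z) (M := - regSol d ε 0)
    (y := 0) (r := 2 * ε)
    (continuous_regSol d hε).neg.continuousOn (fun z _ => neg_le_neg (regSol_zero_le hε z))
    (by rw [integral_neg, h]; linarith)
  have h2 : ‖EuclideanSpace.single (0 : Fin d) (3 / 2 * ε)‖ = 3 / 2 * ε := by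
    rw [PiLp.norm_single, Real.norm_of_nonneg (by positivity)]
  have h3 := h1 (EuclideanSpace.single (0 : Fin d) (3 / 2 * ε)) (by
    rw [mem_ball_zero_iff, h2]; linarith)
  have h4 := regSol_zero_lt hε (z := EuclideanSpace.single (0 : Fin d) (3 / 2 * ε)) (by
    rw [h2]; linarith)
  linarith

lemma hasCompactSupport_ballKer {d : ℕ} [NeZero d] {ε : ℝ} (hε : 0 < ε) :
    HasCompactSupport (ballKer d ε) :=
  HasCompactSupport.intro (isCompact_closedBall 0 (3 * ε)) fun z hz =>
    ballKer_eq_zero hε (by simpa using hz)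

lemma integrable_ballKer {d : ℕ} [NeZero d] {ε : ℝ} (hε : 0 < ε) : Integrable (ballKer d ε) :=
  (continuous_ballKer hε).integrable_of_hasCompactSupport (hasCompactSupport_ballKer hε)

lemma integral_ballKer_pos {d : ℕ} [NeZero d] {ε : ℝ} (hε : 0 < ε) :
    0 < ∫ z, ballKer d ε z :=
  (continuous_ballKer hε).integral_pos_of_hasCompactSupport_nonneg_nonzero
    (hasCompactSupport_ballKer hε) (ballKer_nonneg hε) (ballKer_zero_ne hε)

/-- Fubini for the potential of a measure integrated over a compact set. -/
lemma setIntegral_potential_swap {d : ℕ} {ε : ℝ} (hε : 0 < ε) (μ ν : Measure (Euc d))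
    [IsFiniteMeasureOnCompacts μ] [IsFiniteMeasureOnCompacts ν] [SFinite μ] [SFinite ν]
    {K L : Set (Euc d)} (hK : IsCompact K) (hL : IsCompact L) :
    ∫ z in L, (∫ x in K, regSol d ε (x - z) ∂μ) ∂ν =
      ∫ x in K, (∫ z in L, regSol d ε (x - z) ∂ν) ∂μ := by
  refine integral_integral_swap ?_
  have hc := continuous_regSol d hε
  rw [Measure.prod_restrict]
  refine ContinuousOn.integrableOn_compact (hL.prod hK) ?_
  simp only [Function.uncurry_def]
  exact Continuous.continuousOn (by fun_prop)

/-- Away from the carrier of the measure, the potential has the mean value property. -/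
lemma setIntegral_closedBall_potential {d : ℕ} [NeZero d] {ε : ℝ} (hε : 0 < ε)
    (μ : Measure (Euc d)) [IsFiniteMeasureOnCompacts μ] [SFinite μ]
    {K : Set (Euc d)} (hK : IsCompact K) {y : Euc d} {r : ℝ} (hr : 0 < r)
    (hd : ∀ x ∈ K, ∀ z ∈ closedBall y r, ε ≤ ‖x - z‖) :
    ∫ z in closedBall y r, (∫ x in K, regSol d ε (x - z) ∂μ) =
      (∫ x in K, regSol d ε (x - y) ∂μ) * volume.real (closedBall y r) := by
  rw [setIntegral_potential_swap hε μ volume hK (isCompact_closedBall y r), ← integral_mul_const]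
  refine setIntegral_congr_fun hK.measurableSet fun x hx => ?_
  have h1 : ∫ z in closedBall y r, regSol d ε (x - z) =
      ∫ z in closedBall y r, fundSol d (z - x) := by
    refine setIntegral_congr_fun isClosed_closedBall.measurableSet fun z hz => ?_
    rw [← regSol_neg, neg_sub, regSol_eq_fundSol hε (by rw [norm_sub_rev]; exact hd x hx z hz)]
  have h2 := ((harmOn_fundSol d).comp_sub x).integral_eq (x := y) hr fun z hz => by
    have := hd x hx z hz
    rw [norm_sub_rev] at this
    exact norm_pos_iff.1 (hε.trans_le this)
  rw [h1, h2, ← regSol_neg, neg_sub, regSol_eq_fundSol hε]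
  rw [norm_sub_rev]; exact hd x hx y (mem_closedBall_self hr.le)

/-- The potential of a uniform distribution on a spherical shell is constant inside. -/
lemma setIntegral_shell_eq {d : ℕ} [NeZero d] {R R' : ℝ} {y : Euc d} (hy : ‖y‖ ≤ R) :
    ∫ x in {x : Euc d | R + 2 ≤ ‖x‖ ∧ ‖x‖ ≤ R'}, regSol d 1 (x - y) =
      ∫ x in {x : Euc d | R + 2 ≤ ‖x‖ ∧ ‖x‖ ≤ R'}, regSol d 1 (x - 0) := by
  set A := {x : Euc d | R + 2 ≤ ‖x‖ ∧ ‖x‖ ≤ R'} with hA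
  have hAc : IsCompact A := by
    refine (isCompact_closedBall (0 : Euc d) R').of_isClosed_subset ?_ fun x hx => by
      simpa using hx.2
    exact (isClosed_le continuous_const continuous_norm).inter
      (isClosed_le continuous_norm continuous_const)
  set H : Euc d → ℝ := fun z => ∫ x in A, regSol d 1 (x - z) with hH
  have hHc : Continuous H := continuous_setIntegral_regSol one_pos volume hAc
  have hHh : HarmOn H (ball 0 (R + 1)) := by
    refine harmOn_of_integral_eq hHc.continuousOn fun w r hr hw => ?_
    refine setIntegral_closedBall_potential one_pos volume hAc hr fun x hx z hz => ?_
    have h1 := mem_ball_zero_iff.1 (hw hz)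
    have h2 := norm_sub_norm_le x z
    have h3 := hx.1
    linarith
  rcases eq_or_ne y 0 with rfl | hy0
  · rfl
  have hpos : 0 < ‖y‖ := norm_pos_iff.2 hy0
  have hsub : ball (0 : Euc d) ‖y‖ ⊆ ball 0 (R + 1) := ball_subset_ball (by linarith)
  have hrad : ∀ z ∈ sphere (0 : Euc d) ‖y‖, H z = H y := fun z hz =>
    closedBall_integral_radial 1 (fun T z => by simp [hA]) (mem_sphere_zero_iff_norm.1 hz)
  have h1 := ((hHh.mono hsub).locSub isOpen_ball).le_of_le_sphere hpos hHc.continuousOn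
    (fun z hz => (hrad z hz).le) 0 (mem_closedBall_self hpos.le)
  have h2 := ((hHh.neg.mono hsub).locSub isOpen_ball).le_of_le_sphere hpos hHc.neg.continuousOn
    (B := - H y) (fun z hz => by rw [hrad z hz]) 0 (mem_closedBall_self hpos.le)
  exact le_antisymm (by linarith) h1

lemma eInt_coe {d : ℕ} {μ : Measure (Euc d)} {f : Euc d → ℝ} (hf : Integrable f μ) :
    eInt μ (fun x => (f x : EReal)) = ((∫ x, f x ∂μ : ℝ) : EReal) := by
  have h1 : ∀ x, erealPos (f x : EReal) = ENNReal.ofReal (f x) := fun x => by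
    simp [erealPos]
  have h2 : ∀ x, erealPos (-(f x : EReal)) = ENNReal.ofReal (-f x) := fun x => by
    rw [← EReal.coe_neg]; simp [erealPos]
  rw [eInt, integral_eq_lintegral_pos_part_sub_lintegral_neg_part hf]
  simp only [h1, h2]
  have hp : ∫⁻ x, ENNReal.ofReal (f x) ∂μ ≠ ⊤ := hf.lintegral_lt_top.ne
  have hn : ∫⁻ x, ENNReal.ofReal (-f x) ∂μ ≠ ⊤ := hf.neg.lintegral_lt_top.ne
  rw [EReal.coe_sub, EReal.coe_ennreal_toReal hp, EReal.coe_ennreal_toReal hn]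

lemma MeasCompIn.isFiniteMeasure {d : ℕ} {μ : Measure (Euc d)} {O : Set (Euc d)}
    (h : MeasCompIn μ O) : IsFiniteMeasure μ := ⟨h.2.2.2⟩

lemma MeasCompIn.restrict_eq {d : ℕ} {μ : Measure (Euc d)} {O K : Set (Euc d)}
    (h : MeasCompIn μ O) (hK : msupp μ ⊆ K) : μ.restrict K = μ :=
  Measure.restrict_eq_self_of_ae_mem
    (measure_mono_null (compl_subset_compl.2 hK) h.2.2.1 : μ Kᶜ = 0)

lemma MeasCompIn.integrable {d : ℕ} {μ : Measure (Euc d)} {O : Set (Euc d)}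
    (h : MeasCompIn μ O) {f : Euc d → ℝ} (hf : ContinuousOn f O) : Integrable f μ := by
  have := h.isFiniteMeasure
  rw [← h.restrict_eq subset_rfl]
  exact (hf.mono h.2.1).integrableOn_compact h.1

/-- `ω` is a balayage of `δ` for subharmonic functions on the open set `O`. -/
structure Balayage {d : ℕ} (O : Set (Euc d)) (δ ω : Measure (Euc d)) : Prop where
  isOpen : IsOpen O
  left : MeasCompIn δ O
  right : MeasCompIn ω O
  le : ∀ u : Euc d → EReal, SbhOn u O → eInt δ u ≤ eInt ω u

/-- The difference of the potentials of two measures with a regularised kernel. -/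
def regPot {d : ℕ} (δ ω : Measure (Euc d)) (ε : ℝ) (x : Euc d) : ℝ :=
  (∫ y, regSol d ε (y - x) ∂ω) - ∫ y, regSol d ε (y - x) ∂δ

/-- The difference of the potentials of two measures. -/
def fundPot {d : ℕ} (δ ω : Measure (Euc d)) (x : Euc d) : ℝ :=
  (∫ y, fundSol d (y - x) ∂ω) - ∫ y, fundSol d (y - x) ∂δ

/-- The union of the supports of two measures. -/
def carrier {d : ℕ} (δ ω : Measure (Euc d)) : Set (Euc d) := msupp ω ∪ msupp δ

namespace Balayage

variable {d : ℕ} {O : Set (Euc d)} {δ ω : Measure (Euc d)}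

lemma isCompact_carrier (h : Balayage O δ ω) : IsCompact (carrier δ ω) := h.right.1.union h.left.1

lemma carrier_subset (h : Balayage O δ ω) : carrier δ ω ⊆ O := union_subset h.right.2.1 h.left.2.1

lemma restrict_left (h : Balayage O δ ω) : δ.restrict (carrier δ ω) = δ :=
  h.left.restrict_eq subset_union_right

lemma restrict_right (h : Balayage O δ ω) : ω.restrict (carrier δ ω) = ω :=
  h.right.restrict_eq subset_union_left

lemma integral_le (h : Balayage O δ ω) {f : Euc d → ℝ} (hc : ContinuousOn f O)
    (hf : SbhOn (fun x => (f x : EReal)) O) : ∫ x, f x ∂δ ≤ ∫ x, f x ∂ω := by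
  have := h.le _ hf
  rwa [eInt_coe (h.left.integrable hc), eInt_coe (h.right.integrable hc),
    EReal.coe_le_coe_iff] at this

lemma integral_eq_of_harmOn [NeZero d] (h : Balayage O δ ω) {f : Euc d → ℝ} (hf : HarmOn f O) :
    ∫ x, f x ∂δ = ∫ x, f x ∂ω := by
  refine le_antisymm (h.integral_le hf.1 hf.sbhOn) ?_
  have := h.integral_le hf.neg.1 hf.neg.sbhOn
  rw [integral_neg, integral_neg] at this
  linarith

lemma regPot_nonneg [NeZero d] (h : Balayage O δ ω) {ε : ℝ} (hε : 0 < ε) (x : Euc d) :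
    0 ≤ regPot δ ω ε x :=
  sub_nonneg.2 (h.integral_le ((continuous_regSol d hε).comp (by fun_prop)).continuousOn
    (sbhOn_regSol hε x O))

lemma regPot_eq_setIntegral (h : Balayage O δ ω) (ε : ℝ) (x : Euc d) : regPot δ ω ε x =
    (∫ y in carrier δ ω, regSol d ε (y - x) ∂ω) - ∫ y in carrier δ ω, regSol d ε (y - x) ∂δ := by
  rw [regPot, h.restrict_left, h.restrict_right]

lemma continuous_regPot (h : Balayage O δ ω) {ε : ℝ} (hε : 0 < ε) :
    Continuous (regPot δ ω ε) := by
  have := h.left.isFiniteMeasure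
  have := h.right.isFiniteMeasure
  simp only [funext (h.regPot_eq_setIntegral ε)]
  exact (continuous_setIntegral_regSol hε ω h.isCompact_carrier).sub
    (continuous_setIntegral_regSol hε δ h.isCompact_carrier)

lemma setIntegral_regPot [NeZero d] (h : Balayage O δ ω) {ε : ℝ} (hε : 0 < ε) {y : Euc d} {r : ℝ}
    (hr : 0 < r) (hd : ∀ x ∈ carrier δ ω, ∀ z ∈ closedBall y r, ε ≤ ‖x - z‖) :
    ∫ z in closedBall y r, regPot δ ω ε z =
      regPot δ ω ε y * volume.real (closedBall y r) := by
  have := h.left.isFiniteMeasure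
  have := h.right.isFiniteMeasure
  have hi : ∀ (μ : Measure (Euc d)) [IsFiniteMeasureOnCompacts μ], IntegrableOn
      (fun z => ∫ x in carrier δ ω, regSol d ε (x - z) ∂μ) (closedBall y r) := fun μ _ =>
    (continuous_setIntegral_regSol hε μ h.isCompact_carrier).continuousOn.integrableOn_compact
      (isCompact_closedBall y r)
  simp only [h.regPot_eq_setIntegral]
  rw [integral_sub (hi ω) (hi δ), setIntegral_closedBall_potential hε ω h.isCompact_carrier hr hd,
    setIntegral_closedBall_potential hε δ h.isCompact_carrier hr hd, sub_mul]

lemma regPot_eq_fundPot (h : Balayage O δ ω) {ε : ℝ} (hε : 0 < ε) {x : Euc d}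
    (hd : ∀ y ∈ carrier δ ω, ε ≤ ‖y - x‖) : regPot δ ω ε x = fundPot δ ω x := by
  rw [h.regPot_eq_setIntegral, fundPot]
  have he : EqOn (fun y => regSol d ε (y - x)) (fun y => fundSol d (y - x)) (carrier δ ω) :=
    fun y hy => regSol_eq_fundSol hε (hd y hy)
  rw [setIntegral_congr_fun h.isCompact_carrier.measurableSet he,
    setIntegral_congr_fun h.isCompact_carrier.measurableSet he, h.restrict_left, h.restrict_right]

lemma exists_dist_le (h : Balayage O δ ω) {x : Euc d} (hx : x ∉ carrier δ ω) :
    ∃ ε : ℝ, 0 < ε ∧ ∀ y ∈ carrier δ ω, ∀ z ∈ closedBall x ε, ε ≤ ‖y - z‖ := by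
  obtain ⟨r, hr, hb⟩ := Metric.isOpen_iff.1 h.isCompact_carrier.isClosed.isOpen_compl x hx
  refine ⟨r / 2, by positivity, fun y hy z hz => ?_⟩
  by_contra! hlt
  refine hb (?_ : y ∈ ball x r) hy
  have := dist_triangle y z x
  rw [mem_closedBall] at hz
  rw [← dist_eq_norm] at hlt
  rw [mem_ball]
  linarith

lemma fundPot_nonneg [NeZero d] (h : Balayage O δ ω) {x : Euc d} (hx : x ∉ carrier δ ω) :
    0 ≤ fundPot δ ω x := by
  obtain ⟨ε, hε, hd⟩ := h.exists_dist_le hx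
  rw [← h.regPot_eq_fundPot hε fun y hy => hd y hy x (mem_closedBall_self hε.le)]
  exact h.regPot_nonneg hε x

lemma continuousOn_fundPot (h : Balayage O δ ω) : ContinuousOn (fundPot δ ω) (carrier δ ω)ᶜ := by
  intro x hx
  obtain ⟨ε, hε, hd⟩ := h.exists_dist_le hx
  refine ContinuousAt.continuousWithinAt ?_
  refine (h.continuous_regPot hε).continuousAt.congr ?_
  filter_upwards [closedBall_mem_nhds x hε] with z hz
  exact h.regPot_eq_fundPot hε fun y hy => hd y hy z hz

lemma locSub_neg_fundPot [NeZero d] (h : Balayage O δ ω) :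
    LocSub (fun x => - fundPot δ ω x) (carrier δ ω)ᶜ := by
  intro y hy
  obtain ⟨ε, hε, hd⟩ := h.exists_dist_le hy
  have heq : ∀ z ∈ closedBall y ε, regPot δ ω ε z = fundPot δ ω z := fun z hz =>
    h.regPot_eq_fundPot hε fun x hx => hd x hx z hz
  refine ⟨ε, hε, fun z hz hzS => ?_, ?_⟩
  · have := hd z hzS z hz
    simp at this
    linarith
  · rw [integral_neg, ← setIntegral_congr_fun isClosed_closedBall.measurableSet heq,
      h.setIntegral_regPot hε hε hd, heq y (mem_closedBall_self hε.le)]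
    linarith

lemma fundPot_eq_zero_of_isPreconnected [NeZero d] (h : Balayage O δ ω) {T : Set (Euc d)}
    (hT : IsPreconnected T) (hTS : Disjoint T (carrier δ ω)) {x y : Euc d} (hx : x ∈ T)
    (hy : y ∈ T) (h0 : fundPot δ ω x = 0) : fundPot δ ω y = 0 := by
  have := h.locSub_neg_fundPot.eq_of_isPreconnected h.continuousOn_fundPot.neg (M := 0)
    (fun z hz => neg_nonpos.2 (h.fundPot_nonneg hz)) hT hTS.subset_compl_right hx
    (by simp [h0]) y hy
  simpa using this

lemma fundPot_eq_zero_of_notMem [NeZero d] (h : Balayage O δ ω) {x : Euc d} (hx : x ∉ O) :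
    fundPot δ ω x = 0 := by
  have : HarmOn (fun y => fundSol d (y - x)) O := by
    refine ((harmOn_fundSol d).comp_sub x).mono fun y hy => ?_
    show y - x ≠ 0
    exact sub_ne_zero.2 fun hyx => hx (hyx ▸ hy)
  rw [fundPot, h.integral_eq_of_harmOn this, sub_self]

lemma fundPot_eq_zero_of_norm_gt [NeZero d] (h : Balayage O δ ω) {R : ℝ}
    (hR : carrier δ ω ⊆ closedBall 0 R) {x : Euc d} (hx : R + 2 < ‖x‖) : fundPot δ ω x = 0 := by
  have := h.left.isFiniteMeasure
  have := h.right.isFiniteMeasure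
  have hRx : ∀ y ∈ carrier δ ω, ‖y‖ ≤ R := fun y hy => by simpa using hR hy
  set A := {z : Euc d | R + 2 ≤ ‖z‖ ∧ ‖z‖ ≤ ‖x‖ + 1} with hA
  have hAc : IsCompact A := by
    refine (isCompact_closedBall (0 : Euc d) (‖x‖ + 1)).of_isClosed_subset ?_ fun x hx => by
      simpa using hx.2
    exact (isClosed_le continuous_const continuous_norm).inter
      (isClosed_le continuous_norm continuous_const)
  have hpot : ∀ μ : Measure (Euc d), ∀ [IsFiniteMeasure μ],
      ∫ z in A, (∫ y in carrier δ ω, regSol d 1 (y - z) ∂μ) =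
        μ.real (carrier δ ω) * ∫ z in A, regSol d 1 (z - 0) := by
    intro μ _
    rw [setIntegral_potential_swap one_pos μ volume h.isCompact_carrier hAc]
    have : ∀ y ∈ carrier δ ω, ∫ z in A, regSol d 1 (y - z) = ∫ z in A, regSol d 1 (z - 0) := by
      intro y hy
      rw [← setIntegral_shell_eq (hRx y hy)]
      refine integral_congr_ae (Eventually.of_forall fun z => ?_)
      simp only
      rw [← regSol_neg, neg_sub]
    rw [setIntegral_congr_fun h.isCompact_carrier.measurableSet this, setIntegral_const, smul_eq_mul]
  have hmass : ω.real (carrier δ ω) = δ.real (carrier δ ω) := by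
    have h1 := h.integral_eq_of_harmOn (harmOn_const 1 O)
    have h2 : ∀ μ : Measure (Euc d), μ.restrict (carrier δ ω) = μ →
        μ.real (carrier δ ω) = μ.real univ := fun μ hμ => by
      conv_rhs => rw [← hμ]
      simp [measureReal_def]
    rw [h2 ω h.restrict_right, h2 δ h.restrict_left]
    simpa using h1.symm
  have hi : ∀ (μ : Measure (Euc d)) [IsFiniteMeasureOnCompacts μ], IntegrableOn
      (fun z => ∫ x in carrier δ ω, regSol d 1 (x - z) ∂μ) A := fun μ _ =>
    (continuous_setIntegral_regSol one_pos μ h.isCompact_carrier).continuousOn.integrableOn_compact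
      hAc
  have hzero : ∫ z in A, regPot δ ω 1 z = 0 := by
    simp only [h.regPot_eq_setIntegral]
    rw [integral_sub (hi ω) (hi δ), hpot ω, hpot δ, hmass, sub_self]
  have hae := (setIntegral_eq_zero_iff_of_nonneg_ae (Eventually.of_forall fun z =>
    h.regPot_nonneg one_pos z) ((h.continuous_regPot one_pos).continuousOn.integrableOn_compact
      hAc)).1 hzero
  have hopen : IsOpen {z : Euc d | R + 2 < ‖z‖ ∧ ‖z‖ < ‖x‖ + 1} :=
    (isOpen_lt continuous_const continuous_norm).inter
      (isOpen_lt continuous_norm continuous_const)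
  have hsub : {z : Euc d | R + 2 < ‖z‖ ∧ ‖z‖ < ‖x‖ + 1} ⊆ A := fun z hz => ⟨hz.1.le, hz.2.le⟩
  have heq := Measure.eqOn_open_of_ae_eq (ae_restrict_of_ae_restrict_of_subset hsub hae) hopen (h.continuous_regPot one_pos).continuousOn
    continuousOn_const
  have hx0 := heq (show x ∈ {z : Euc d | R + 2 < ‖z‖ ∧ ‖z‖ < ‖x‖ + 1} from ⟨hx, by linarith⟩)
  rw [← h.regPot_eq_fundPot one_pos fun y hy => ?_]
  · simpa using hx0
  · have h1 := norm_sub_norm_le x y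
    rw [norm_sub_rev] at h1
    have h2 := hRx y hy
    linarith

lemma fundPot_eq_zero_of_notMem_infill [NeZero d] (h : Balayage O δ ω) {x : Euc d}
    (hx : x ∉ infill O (carrier δ ω)) : fundPot δ ω x = 0 := by
  by_cases hxO : x ∈ O
  swap
  · exact h.fundPot_eq_zero_of_notMem hxO
  have hxS : x ∉ carrier δ ω := fun hxS => hx (Or.inl hxS)
  set C := connectedComponentIn (O \ carrier δ ω) x with hC
  have hxC : x ∈ C := mem_connectedComponentIn ⟨hxO, hxS⟩
  have hCS : Disjoint C (carrier δ ω) :=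
    disjoint_left.2 fun z hz => (connectedComponentIn_subset _ _ hz).2
  have hCp : IsPreconnected C := isPreconnected_connectedComponentIn
  by_cases hcl : closure C ⊆ O
  · have hnc : ¬ IsCompact (closure C) := fun hc => hx (Or.inr ⟨x, ⟨hxO, hxS⟩, hxC, hc, hcl⟩)
    obtain ⟨R, hR⟩ := h.isCompact_carrier.isBounded.subset_closedBall (0 : Euc d)
    obtain ⟨y, hyC, hy⟩ : ∃ y ∈ C, R + 2 < ‖y‖ := by
      by_contra! hb
      refine hnc (Metric.isCompact_of_isClosed_isBounded isClosed_closure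
        (Bornology.IsBounded.closure (isBounded_closedBall.subset
          (fun y hy => ?_ : C ⊆ closedBall 0 (R + 2)))))
      simpa using hb y hy
    exact h.fundPot_eq_zero_of_isPreconnected hCp hCS hyC hxC (h.fundPot_eq_zero_of_norm_gt hR hy)
  · obtain ⟨z, hzC, hzO⟩ := not_subset.1 hcl
    have hp : IsPreconnected (insert z C) := hCp.subset_closure (subset_insert _ _)
      (insert_subset hzC subset_closure)
    have hd : Disjoint (insert z C) (carrier δ ω) :=
      disjoint_insert_left.2 ⟨fun hz => hzO (h.carrier_subset hz), hCS⟩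
    exact h.fundPot_eq_zero_of_isPreconnected hp hd (mem_insert _ _) (mem_insert_of_mem _ hxC)
      (h.fundPot_eq_zero_of_notMem hzO)

lemma exists_compact_fundPot_eq_zero [NeZero d] (h : Balayage O δ ω) :
    ∃ Z : Set (Euc d), IsCompact Z ∧ carrier δ ω ⊆ Z ∧ Z ⊆ infill O (carrier δ ω) ∧
      ∀ x ∉ Z, fundPot δ ω x = 0 := by
  obtain ⟨R, hR⟩ := h.isCompact_carrier.isBounded.subset_closedBall (0 : Euc d)
  refine ⟨{x | x ∉ carrier δ ω → fundPot δ ω x ≠ 0}, ?_, fun x hx hn => (hn hx).elim,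
    fun x hx => ?_, fun x hx => ?_⟩
  · refine Metric.isCompact_of_isClosed_isBounded (isOpen_compl_iff.1 ?_)
      (isBounded_closedBall.subset (fun x hx => ?_ :
        _ ⊆ closedBall (0 : Euc d) (R + 2)))
    · refine Metric.isOpen_iff.2 fun x hx => ?_
      simp only [ne_eq, mem_compl_iff, mem_ofPred_eq, Classical.not_imp, not_not] at hx
      obtain ⟨r, hr, hb⟩ := Metric.isOpen_iff.1 h.isCompact_carrier.isClosed.isOpen_compl x hx.1
      refine ⟨r, hr, fun y hy hn => hn (hb hy) ?_⟩
      exact h.fundPot_eq_zero_of_isPreconnected (convex_ball x r).isPreconnected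
        (disjoint_left.2 hb) (mem_ball_self hr) hy hx.2
    · by_contra hn
      rw [mem_closedBall_zero_iff, not_le] at hn
      refine hx (fun hxS => ?_) (h.fundPot_eq_zero_of_norm_gt hR hn)
      have := hR hxS
      rw [mem_closedBall_zero_iff] at this
      linarith
  · by_contra hn
    exact hx (fun hxS => hn (Or.inl hxS)) (h.fundPot_eq_zero_of_notMem_infill hn)
  · simp only [ne_eq, mem_ofPred_eq, Classical.not_imp, not_not] at hx
    exact hx.2

end Balayage

/-- The integral of a function against a translate of `ballKer`. -/
def ballConv {d : ℕ} (v : Euc d → ℝ) (ε : ℝ) (y : Euc d) : ℝ := ∫ x, v x * ballKer d ε (x - y)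

lemma integrable_prod_ballKer {d : ℕ} [NeZero d] {v : Euc d → ℝ} (hv : Integrable v)
    (μ : Measure (Euc d)) [IsFiniteMeasure μ] {ε : ℝ} (hε : 0 < ε) :
    Integrable (fun p : Euc d × Euc d => v p.1 * ballKer d ε (p.1 - p.2))
      ((volume : Measure (Euc d)).prod μ) := by
  obtain ⟨C, hC⟩ := (continuous_ballKer (d := d) hε).bounded_above_of_compact_support
    (hasCompactSupport_ballKer hε)
  have hk := continuous_ballKer (d := d) hε
  have h1 : Integrable (fun p : Euc d × Euc d => v p.1) ((volume : Measure (Euc d)).prod μ) :=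
    hv.comp_fst μ
  exact h1.mul_bdd (c := C) (Continuous.aestronglyMeasurable (by fun_prop))
    (Eventually.of_forall fun p => hC _)

lemma integrable_ballConv {d : ℕ} [NeZero d] {v : Euc d → ℝ} (hv : Integrable v)
    (μ : Measure (Euc d)) [IsFiniteMeasure μ] {ε : ℝ} (hε : 0 < ε) :
    Integrable (ballConv v ε) μ :=
  (integrable_prod_ballKer hv μ hε).integral_prod_right

lemma integrable_mul_integral_ballKer {d : ℕ} [NeZero d] {v : Euc d → ℝ} (hv : Integrable v)
    (μ : Measure (Euc d)) [IsFiniteMeasure μ] {ε : ℝ} (hε : 0 < ε) :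
    Integrable (fun x => v x * ∫ y, ballKer d ε (x - y) ∂μ) := by
  have := (integrable_prod_ballKer hv μ hε).integral_prod_left
  simpa only [integral_const_mul] using this

lemma integral_ballConv {d : ℕ} [NeZero d] {v : Euc d → ℝ} (hv : Integrable v)
    (μ : Measure (Euc d)) [IsFiniteMeasure μ] {ε : ℝ} (hε : 0 < ε) :
    ∫ y, ballConv v ε y ∂μ = ∫ x, v x * ∫ y, ballKer d ε (x - y) ∂μ := by
  simp only [← integral_const_mul]
  exact (integral_integral_swap (f := fun x y => v x * ballKer d ε (x - y))
    (integrable_prod_ballKer hv μ hε)).symm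

lemma integral_mul_setIntegral_closedBall {d : ℕ} {v p : Euc d → ℝ} (hv : Integrable v)
    (hp : Integrable p) (r : ℝ) :
    Integrable (fun x => v x * ∫ z in closedBall x r, p z) ∧
    Integrable (fun z => p z * ∫ x in closedBall z r, v x) ∧
    ∫ x, v x * ∫ z in closedBall x r, p z = ∫ z, p z * ∫ x in closedBall z r, v x := by
  have hm : MeasurableSet {q : Euc d × Euc d | dist q.1 q.2 ≤ r} :=
    (isClosed_le continuous_dist continuous_const).measurableSet
  have hi : Integrable (fun q : Euc d × Euc d =>
      {q : Euc d × Euc d | dist q.1 q.2 ≤ r}.indicator (fun q => v q.1 * p q.2) q)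
      ((volume : Measure (Euc d)).prod volume) := (hv.mul_prod hp).indicator hm
  have h1 : ∀ x, ∫ z, {q : Euc d × Euc d | dist q.1 q.2 ≤ r}.indicator
      (fun q => v q.1 * p q.2) (x, z) = v x * ∫ z in closedBall x r, p z := fun x => by
    rw [← integral_const_mul, ← integral_indicator isClosed_closedBall.measurableSet]
    refine integral_congr_ae (Eventually.of_forall fun z => ?_)
    simp only [indicator, mem_ofPred_eq, mem_closedBall, dist_comm x z]
  have h2 : ∀ z, ∫ x, {q : Euc d × Euc d | dist q.1 q.2 ≤ r}.indicator
      (fun q => v q.1 * p q.2) (x, z) = p z * ∫ x in closedBall z r, v x := fun z => by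
    rw [← integral_const_mul, ← integral_indicator isClosed_closedBall.measurableSet]
    refine integral_congr_ae (Eventually.of_forall fun x => ?_)
    simp only [indicator, mem_ofPred_eq, mem_closedBall, mul_comm (p z)]
  refine ⟨?_, ?_, ?_⟩
  · simpa only [h1] using hi.integral_prod_left
  · simpa only [h2] using hi.integral_prod_right
  · have := integral_integral_swap (f := fun x z => {q : Euc d × Euc d | dist q.1 q.2 ≤ r}.indicator
      (fun q => v q.1 * p q.2) (x, z)) hi
    simpa only [h1, h2] using this

lemma regSol_sub_comm {d : ℕ} (ε : ℝ) (x y : Euc d) : regSol d ε (x - y) = regSol d ε (y - x) := by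
  rw [← regSol_neg, neg_sub]

namespace Balayage

variable {d : ℕ} {O : Set (Euc d)} {δ ω : Measure (Euc d)}

lemma integral_ballKer_sub [NeZero d] (h : Balayage O δ ω) {ε : ℝ} (hε : 0 < ε) (x : Euc d) :
    (∫ y, ballKer d ε (x - y) ∂ω) - ∫ y, ballKer d ε (x - y) ∂δ =
      (∫ z in closedBall x (2 * ε), regPot δ ω ε z) -
        volume.real (closedBall (0 : Euc d) (2 * ε)) * regPot δ ω ε x := by
  have := h.left.isFiniteMeasure
  have := h.right.isFiniteMeasure
  have hr := continuous_regSol d hε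
  have hk : ∀ y, ballKer d ε (x - y) = (∫ z in closedBall x (2 * ε), regSol d ε (y - z)) -
      volume.real (closedBall (0 : Euc d) (2 * ε)) * regSol d ε (y - x) := fun y => by
    rw [ballKer_eq, ← setIntegral_closedBall_sub, ← regSol_neg _ (x - y), neg_sub]
    simp only [regSol_sub_comm ε _ y]
  have hμ : ∀ (μ : Measure (Euc d)) [IsFiniteMeasure μ], μ.restrict (carrier δ ω) = μ →
      ∫ y, ballKer d ε (x - y) ∂μ =
        (∫ z in closedBall x (2 * ε), (∫ y in carrier δ ω, regSol d ε (y - z) ∂μ)) -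
        volume.real (closedBall (0 : Euc d) (2 * ε)) *
          ∫ y in carrier δ ω, regSol d ε (y - x) ∂μ := by
    intro μ _ hμ
    rw [setIntegral_potential_swap hε μ volume h.isCompact_carrier (isCompact_closedBall _ _),
      ← integral_const_mul]
    conv_lhs => rw [← hμ]
    simp only [hk]
    refine integral_sub ?_ ?_
    · have hc : Continuous fun y : Euc d => ∫ z in closedBall x (2 * ε), regSol d ε (y - z) := by
        have := continuous_setIntegral_regSol hε volume (isCompact_closedBall x (2 * ε))
        simpa only [regSol_sub_comm ε _ (_ : Euc d)] using this
      exact hc.continuousOn.integrableOn_compact h.isCompact_carrier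
    · exact (Continuous.continuousOn (by fun_prop)).integrableOn_compact h.isCompact_carrier
  have hi : ∀ (μ : Measure (Euc d)) [IsFiniteMeasureOnCompacts μ], IntegrableOn
      (fun z => ∫ x in carrier δ ω, regSol d ε (x - z) ∂μ) (closedBall x (2 * ε)) := fun μ _ =>
    (continuous_setIntegral_regSol hε μ h.isCompact_carrier).continuousOn.integrableOn_compact
      (isCompact_closedBall _ _)
  rw [hμ ω h.restrict_right, hμ δ h.restrict_left]
  simp only [h.regPot_eq_setIntegral]
  rw [integral_sub (hi ω) (hi δ)]
  ring

lemma integral_ballConv_le [NeZero d] (h : Balayage O δ ω) {Z : Set (Euc d)} (hZc : IsCompact Z)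
    (hSZ : carrier δ ω ⊆ Z) (hZ : ∀ x ∉ Z, fundPot δ ω x = 0) {v : Euc d → ℝ}
    (hv : Integrable v) {ε : ℝ} (hε : 0 < ε)
    (hsub : ∀ z ∈ cthickening ε Z,
      v z * volume.real (closedBall z (2 * ε)) ≤ ∫ x in closedBall z (2 * ε), v x) :
    ∫ y, ballConv v ε y ∂δ ≤ ∫ y, ballConv v ε y ∂ω := by
  have := h.left.isFiniteMeasure
  have := h.right.isFiniteMeasure
  have hp0 : ∀ z ∉ cthickening ε Z, regPot δ ω ε z = 0 := fun z hz => by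
    have hd : ∀ y ∈ Z, ε ≤ ‖y - z‖ := fun y hy => by
      by_contra! hlt
      refine hz (mem_cthickening_of_dist_le z y ε Z hy ?_)
      rw [dist_comm, dist_eq_norm]
      exact hlt.le
    rw [h.regPot_eq_fundPot hε fun y hy => hd y (hSZ hy)]
    exact hZ z fun hzZ => by simpa using (hε.trans_le (hd z hzZ)).ne'
  have hp : Integrable (regPot δ ω ε) := (h.continuous_regPot hε).integrable_of_hasCompactSupport
    (HasCompactSupport.intro hZc.cthickening hp0)
  obtain ⟨h1, h2, h3⟩ := integral_mul_setIntegral_closedBall hv hp (2 * ε)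
  have hvp : Integrable fun x => v x * regPot δ ω ε x := by
    obtain ⟨C, hC⟩ := (h.continuous_regPot hε).bounded_above_of_compact_support
      (HasCompactSupport.intro hZc.cthickening hp0)
    exact hv.mul_bdd (c := C) (h.continuous_regPot hε).aestronglyMeasurable
      (Eventually.of_forall hC)
  rw [← sub_nonneg, integral_ballConv hv ω hε, integral_ballConv hv δ hε,
    ← integral_sub (integrable_mul_integral_ballKer hv ω hε)
      (integrable_mul_integral_ballKer hv δ hε)]
  have heq : ∀ x, v x * (∫ y, ballKer d ε (x - y) ∂ω) - v x * ∫ y, ballKer d ε (x - y) ∂δ =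
      v x * (∫ z in closedBall x (2 * ε), regPot δ ω ε z) -
        volume.real (closedBall (0 : Euc d) (2 * ε)) * (v x * regPot δ ω ε x) := fun x => by
    rw [← mul_sub, h.integral_ballKer_sub hε]
    ring
  simp only [heq]
  rw [integral_sub h1 (hvp.const_mul _), h3, ← integral_sub h2 (hvp.const_mul _)]
  refine integral_nonneg fun z => ?_
  simp only [Pi.zero_apply]
  by_cases hz : z ∈ cthickening ε Z
  · have := mul_le_mul_of_nonneg_left (hsub z hz) (h.regPot_nonneg hε z)
    rw [volume_real_closedBall_center] at this
    linarith
  · simp [hp0 z hz]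

end Balayage

lemma integrable_mul_ballKer {d : ℕ} [NeZero d] {v : Euc d → ℝ} (hv : Integrable v)
    {ε : ℝ} (hε : 0 < ε) (y : Euc d) : Integrable fun x => v x * ballKer d ε (x - y) := by
  obtain ⟨C, hC⟩ := (continuous_ballKer (d := d) hε).bounded_above_of_compact_support
    (hasCompactSupport_ballKer hε)
  have hk := continuous_ballKer (d := d) hε
  exact hv.mul_bdd (c := C) (Continuous.aestronglyMeasurable (by fun_prop))
    (Eventually.of_forall fun p => hC _)

lemma ballConv_le {d : ℕ} [NeZero d] {v : Euc d → ℝ} (hv : Integrable v)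
    {ε : ℝ} (hε : 0 < ε) {y : Euc d} {b : ℝ} (hb : ∀ x ∈ closedBall y (3 * ε), v x ≤ b) :
    ballConv v ε y ≤ b * ∫ z, ballKer d ε z := by
  rw [← integral_sub_right_eq_self (ballKer d ε) y, ← integral_const_mul]
  refine integral_mono (integrable_mul_ballKer hv hε y)
    (((integrable_ballKer hε).comp_sub_right y).const_mul b) fun x => ?_
  by_cases hx : x ∈ closedBall y (3 * ε)
  · exact mul_le_mul_of_nonneg_right (hb x hx) (ballKer_nonneg hε _)
  · rw [mem_closedBall, dist_eq_norm, not_le] at hx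
    simp [ballKer_eq_zero hε hx]

lemma ballConv_neg {d : ℕ} (v : Euc d → ℝ) (ε : ℝ) (y : Euc d) :
    ballConv (fun x => - v x) ε y = - ballConv v ε y := by
  simp [ballConv, integral_neg]

lemma abs_ballConv_div_le {d : ℕ} [NeZero d] {v : Euc d → ℝ} (hv : Integrable v)
    {ε : ℝ} (hε : 0 < ε) {M : ℝ} (hM : ∀ x, |v x| ≤ M) (y : Euc d) :
    |ballConv v ε y / ∫ z, ballKer d ε z| ≤ M := by
  have hc := integral_ballKer_pos (d := d) hε
  have h1 := ballConv_le hv hε (y := y) fun x _ => (abs_le.1 (hM x)).2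
  have h2 := ballConv_le hv.neg hε (y := y) (b := M) fun x _ => neg_le.1 (abs_le.1 (hM x)).1
  have h3 := ballConv_neg v ε y
  rw [abs_le, le_div_iff₀ hc, div_le_iff₀ hc]
  refine ⟨?_, h1⟩
  have : ballConv (-v) ε y = - ballConv v ε y := h3
  linarith

lemma tendsto_ballConv_div {d : ℕ} [NeZero d] {v : Euc d → ℝ} (hv : Integrable v) {y : Euc d}
    (hu : UpperSemicontinuousAt v y)
    (hs : ∀ᶠ ε in 𝓝[>] (0 : ℝ), v y * ∫ z, ballKer d ε z ≤ ballConv v ε y) :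
    Tendsto (fun ε => ballConv v ε y / ∫ z, ballKer d ε z) (𝓝[>] 0) (𝓝 (v y)) := by
  refine tendsto_order.2 ⟨fun a ha => ?_, fun a ha => ?_⟩
  · filter_upwards [hs, self_mem_nhdsWithin] with ε hle hε
    exact ha.trans_le ((le_div_iff₀ (integral_ballKer_pos hε)).2 hle)
  · obtain ⟨b, hb, hba⟩ := exists_between ha
    obtain ⟨r, hr, hball⟩ := Metric.eventually_nhds_iff_ball.1 (hu b hb)
    filter_upwards [Ioo_mem_nhdsGT (show (0 : ℝ) < r / 3 by positivity)] with ε hε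
    refine lt_of_le_of_lt ((div_le_iff₀ (integral_ballKer_pos hε.1)).2 (ballConv_le hv hε.1
      fun x hx => (hball x (closedBall_subset_ball (by linarith [hε.2]) hx)).le)) hba

namespace Balayage

variable {d : ℕ} {O : Set (Euc d)} {δ ω : Measure (Euc d)}

lemma integral_le_of_sbhOn_real [NeZero d] (h : Balayage O δ ω) {u : Euc d → ℝ} {V : Set (Euc d)}
    (hVo : IsOpen V) (hV : infill O (carrier δ ω) ⊆ V) (hu : SbhOn (fun x => (u x : EReal)) V)
    (hb : ∀ K ⊆ V, IsCompact K → ∃ M, ∀ x ∈ K, |u x| ≤ M) :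
    ∫ x, u x ∂δ ≤ ∫ x, u x ∂ω := by
  have := h.left.isFiniteMeasure
  have := h.right.isFiniteMeasure
  obtain ⟨Z, hZc, hSZ, hZi, hZ0⟩ := h.exists_compact_fundPot_eq_zero
  obtain ⟨η, hη, hηV⟩ := hZc.exists_cthickening_subset_open hVo (hZi.trans hV)
  set W := cthickening η Z with hW
  have hWc : IsCompact W := hZc.cthickening
  have hZW : Z ⊆ W := self_subset_cthickening Z
  obtain ⟨M, hM⟩ := hb W hηV hWc
  have hball : ∀ y ∈ Z, ∀ r, r ≤ η → closedBall y r ⊆ W := fun y hy r hr =>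
    (closedBall_subset_closedBall hr).trans (closedBall_subset_cthickening hy η)
  set v := W.indicator u with hv_def
  have hvW : ∀ x ∈ W, v x = u x := fun x hx => indicator_of_mem hx u
  have hvm : Measurable v := by
    have := (UpperSemicontinuousOn.measurable_indicator hu.upperSemicontinuousOn_real hVo).indicator
      hWc.measurableSet
    rwa [indicator_indicator, inter_eq_left.2 hηV] at this
  have hvM : ∀ x, |v x| ≤ max M 0 := fun x => by
    by_cases hx : x ∈ W
    · rw [hvW x hx]; exact (hM x hx).trans (le_max_left _ _)
    · simp [hv_def, hx]
  have hv : Integrable v := by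
    refine (integrable_indicator_iff hWc.measurableSet).2 ?_
    refine IntegrableOn.congr_fun (f := v) ?_ hvW hWc.measurableSet
    exact Measure.integrableOn_of_bounded hWc.measure_lt_top.ne hvm.aestronglyMeasurable
      (Eventually.of_forall hvM)
  have hae : ∀ μ : Measure (Euc d), μ.restrict (carrier δ ω) = μ →
      ∀ᵐ x ∂μ, x ∈ carrier δ ω := fun μ hμ => by
    rw [← hμ]
    exact ae_restrict_mem h.isCompact_carrier.measurableSet
  have hcongr : ∀ μ : Measure (Euc d), μ.restrict (carrier δ ω) = μ →
      ∫ x, v x ∂μ = ∫ x, u x ∂μ := fun μ hμ => by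
    refine integral_congr_ae ?_
    filter_upwards [hae μ hμ] with x hx
    exact hvW x (hZW (hSZ hx))
  have hs : ∀ y ∈ carrier δ ω, ∀ ε, 0 < ε → 3 * ε ≤ η →
      v y * ∫ z, ballKer d ε z ≤ ballConv v ε y := by
    intro y hy ε hε hεη
    have hyW := hball y (hSZ hy) (3 * ε) hεη
    have h1 := (hu.mul_integral_le hVo (hyW.trans hηV) (fun z hz => hM z (hyW hz))
      (integrable_ballKer hε) (ballKer_nonneg hε) (fun z hz => ballKer_eq_zero hε hz)
      (fun z w hzw => ballKer_eq_of_norm_eq ε hzw)).2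
    rw [hvW y (hZW (hSZ hy))]
    refine h1.trans_eq ?_
    rw [ballConv, ← integral_add_left_eq_self (fun x => v x * ballKer d ε (x - y)) y]
    refine integral_congr_ae (Eventually.of_forall fun z => ?_)
    simp only [add_sub_cancel_left]
    by_cases hz : ‖z‖ ≤ 3 * ε
    · rw [hvW (y + z) (hyW (by simpa using hz)), mul_comm]
    · simp [ballKer_eq_zero hε (not_le.1 hz)]
  have hle : ∀ ε, 0 < ε → 3 * ε ≤ η →
      ∫ y, ballConv v ε y ∂δ ≤ ∫ y, ballConv v ε y ∂ω := by
    intro ε hε hεη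
    refine h.integral_ballConv_le hZc hSZ hZ0 hv hε fun z hz => ?_
    have hzW : closedBall z (2 * ε) ⊆ W := by
      rw [hZc.cthickening_eq_biUnion_closedBall hε.le, mem_iUnion₂] at hz
      obtain ⟨y, hy, hyz⟩ := hz
      rw [mem_closedBall] at hyz
      exact (closedBall_subset_closedBall' (by linarith)).trans (hball y hy η le_rfl)
    rw [hvW z (hzW (mem_closedBall_self (by positivity))),
      setIntegral_congr_fun isClosed_closedBall.measurableSet fun x hx => hvW x (hzW hx)]
    exact hu.mul_volume_le hVo (hzW.trans hηV) fun x hx => hM x (hzW hx)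
  have hsmall : ∀ᶠ ε in 𝓝[>] (0 : ℝ), 0 < ε ∧ 3 * ε ≤ η := by
    filter_upwards [Ioo_mem_nhdsGT (show (0 : ℝ) < η / 3 by positivity)] with ε hε
    exact ⟨hε.1, by linarith [hε.2]⟩
  have hlim : ∀ μ : Measure (Euc d), ∀ [IsFiniteMeasure μ], μ.restrict (carrier δ ω) = μ →
      Tendsto (fun ε => ∫ y, ballConv v ε y / (∫ z, ballKer d ε z) ∂μ) (𝓝[>] 0)
        (𝓝 (∫ y, v y ∂μ)) := by
    intro μ _ hμ
    refine tendsto_integral_filter_of_dominated_convergence (fun _ => max M 0) ?_ ?_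
      (integrable_const _) ?_
    · filter_upwards [hsmall] with ε hε
      exact ((integrable_ballConv hv μ hε.1).div_const _).aestronglyMeasurable
    · filter_upwards [hsmall] with ε hε
      exact Eventually.of_forall fun y => abs_ballConv_div_le hv hε.1 hvM y
    · filter_upwards [hae μ hμ] with y hy
      refine tendsto_ballConv_div hv ?_ ?_
      · have hWn : W ∈ 𝓝 y := mem_of_superset (closedBall_mem_nhds y hη)
          (hball y (hSZ hy) η le_rfl)
        intro a ha
        rw [hvW y (hZW (hSZ hy))] at ha
        have := (hu.upperSemicontinuousOn_real y (hηV (hZW (hSZ hy))) a ha)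
        rw [hVo.nhdsWithin_eq (hηV (hZW (hSZ hy)))] at this
        filter_upwards [this, hWn] with x hx hxW
        rwa [hvW x hxW]
      · filter_upwards [hsmall] with ε hε
        exact hs y hy ε hε.1 hε.2
  rw [← hcongr δ h.restrict_left, ← hcongr ω h.restrict_right]
  refine le_of_tendsto_of_tendsto (hlim δ h.restrict_left) (hlim ω h.restrict_right) ?_
  filter_upwards [hsmall] with ε hε
  rw [integral_div, integral_div]
  exact div_le_div_of_nonneg_right (hle ε hε.1 hε.2) (integral_ballKer_pos hε.1).le

end Balayage

lemma erealPos_eq_toENNReal (x : EReal) : erealPos x = x.toENNReal := rfl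

lemma eInt_mono {d : ℕ} {μ : Measure (Euc d)} {u w : Euc d → EReal} (h : ∀ᵐ x ∂μ, u x ≤ w x) :
    eInt μ u ≤ eInt μ w := by
  refine EReal.sub_le_sub (EReal.coe_ennreal_le_coe_ennreal_iff.2 (lintegral_mono_ae ?_))
    (EReal.coe_ennreal_le_coe_ennreal_iff.2 (lintegral_mono_ae ?_))
  · filter_upwards [h] with x hx using EReal.toENNReal_le_toENNReal hx
  · filter_upwards [h] with x hx using EReal.toENNReal_le_toENNReal (EReal.neg_le_neg_iff.2 hx)

/-- The truncation of an extended real valued function from below, made real valued. -/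
def lowerTrunc {d : ℕ} (u : Euc d → EReal) (n : ℕ) (x : Euc d) : ℝ :=
  (max (u x) ((-n : ℝ) : EReal)).toReal

lemma coe_lowerTrunc {d : ℕ} {u : Euc d → EReal} {x : Euc d} (hx : u x < ⊤) (n : ℕ) :
    (lowerTrunc u n x : EReal) = max (u x) ((-n : ℝ) : EReal) := by
  refine EReal.coe_toReal (max_lt hx (EReal.coe_lt_top _)).ne ?_
  exact ((EReal.bot_lt_coe _).trans_le (le_max_right _ _)).ne'

lemma SbhOn.sbhOn_lowerTrunc {d : ℕ} [NeZero d] {u : Euc d → EReal} {V : Set (Euc d)}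
    (hu : SbhOn u V) (n : ℕ) : SbhOn (fun x => (lowerTrunc u n x : EReal)) V := by
  refine ⟨fun x hx a ha => ?_, fun x _ => EReal.coe_lt_top _, fun x r hr hV h hc hh hs y hy => ?_⟩
  · simp only [coe_lowerTrunc (hu.2.1 x hx), max_lt_iff] at ha
    filter_upwards [hu.1 x hx a ha.1, self_mem_nhdsWithin] with z hz hzV
    rw [coe_lowerTrunc (hu.2.1 z hzV)]
    exact max_lt hz ha.2
  · have hs' : ∀ z ∈ sphere x r, u z ≤ h z ∧ ((-n : ℝ) : EReal) ≤ h z := fun z hz => by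
      have : (lowerTrunc u n z : EReal) ≤ h z := hs z hz
      rwa [coe_lowerTrunc (hu.2.1 z (hV (sphere_subset_closedBall hz))), max_le_iff] at this
    simp only [coe_lowerTrunc (hu.2.1 y (hV hy))]
    refine max_le (hu.2.2 x r hr hV h hc hh (fun z hz => (hs' z hz).1) y hy) ?_
    have := (hh.neg.locSub isOpen_ball).le_of_le_sphere hr hc.neg (B := n) (fun z hz => ?_) y hy
    · exact EReal.coe_le_coe_iff.2 (by linarith)
    · have := EReal.coe_le_coe_iff.1 (hs' z hz).2
      linarith

lemma lowerTrunc_bounded {d : ℕ} {u : Euc d → EReal} {V K : Set (Euc d)} {n : ℕ}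
    (hu : SbhOn (fun x => (lowerTrunc u n x : EReal)) V) (hut : ∀ x ∈ V, u x < ⊤)
    (hKV : K ⊆ V) (hK : IsCompact K) : ∃ M, ∀ x ∈ K, |lowerTrunc u n x| ≤ M := by
  obtain ⟨M, hM⟩ := (hu.upperSemicontinuousOn_real.mono hKV).bddAbove_of_isCompact hK
  refine ⟨max M n, fun x hx => abs_le.2 ⟨?_, (hM (mem_image_of_mem _ hx)).trans (le_max_left _ _)⟩⟩
  have h1 : ((-n : ℝ) : EReal) ≤ lowerTrunc u n x := by
    rw [coe_lowerTrunc (hut x (hKV hx))]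
    exact le_max_right _ _
  have h2 := EReal.coe_le_coe_iff.1 h1
  have := le_max_right M n
  linarith

lemma lowerTrunc_antitone {d : ℕ} {u : Euc d → EReal} {x : Euc d} (hx : u x < ⊤) :
    Antitone fun n => (lowerTrunc u n x : EReal) := fun m n hmn => by
  simp only [coe_lowerTrunc hx]
  exact max_le_max le_rfl (EReal.coe_le_coe_iff.2 (neg_le_neg (Nat.cast_le.2 hmn)))

lemma tendsto_lowerTrunc {d : ℕ} {u : Euc d → EReal} {x : Euc d} (hx : u x < ⊤) :
    Tendsto (fun n => (lowerTrunc u n x : EReal)) atTop (𝓝 (u x)) := by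
  simp only [coe_lowerTrunc hx]
  have h : Tendsto (fun n : ℕ => ((-n : ℝ) : EReal)) atTop (𝓝 ⊥) :=
    EReal.tendsto_coe_nhds_bot_iff.2 (tendsto_neg_atTop_atBot.comp tendsto_natCast_atTop_atTop)
  simpa using (tendsto_const_nhds (x := u x)).max h

namespace Balayage

variable {d : ℕ} {O : Set (Euc d)} {δ ω : Measure (Euc d)}

lemma eInt_le [NeZero d] (h : Balayage O δ ω) {u : Euc d → EReal} {V : Set (Euc d)}
    (hVo : IsOpen V) (hV : infill O (carrier δ ω) ⊆ V) (hu : SbhOn u V) :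
    eInt δ u ≤ eInt ω u := by
  have := h.left.isFiniteMeasure
  have := h.right.isFiniteMeasure
  have hSV : carrier δ ω ⊆ V := subset_union_left.trans hV
  have hae : ∀ μ : Measure (Euc d), μ.restrict (carrier δ ω) = μ →
      ∀ᵐ x ∂μ, x ∈ carrier δ ω := fun μ hμ => by
    rw [← hμ]
    exact ae_restrict_mem h.isCompact_carrier.measurableSet
  have hint : ∀ μ : Measure (Euc d), ∀ [IsFiniteMeasure μ], μ.restrict (carrier δ ω) = μ →
      ∀ n, Integrable (lowerTrunc u n) μ := by
    intro μ _ hμ n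
    obtain ⟨M, hM⟩ := lowerTrunc_bounded (hu.sbhOn_lowerTrunc n) hu.2.1 hSV h.isCompact_carrier
    have hm := (hu.sbhOn_lowerTrunc n).upperSemicontinuousOn_real.measurable_indicator hVo
    refine Integrable.of_bound (hm.aestronglyMeasurable.congr ?_) M ?_
    · filter_upwards [hae μ hμ] with x hx using indicator_of_mem (hSV hx) _
    · filter_upwards [hae μ hμ] with x hx using hM x hx
  have hle : ∀ n, eInt δ u ≤ eInt ω fun x => (lowerTrunc u n x : EReal) := by
    intro n
    refine (eInt_mono (w := fun x => (lowerTrunc u n x : EReal)) ?_).trans ?_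
    · filter_upwards [hae δ h.restrict_left] with x hx
      rw [coe_lowerTrunc (hu.2.1 x (hSV hx))]
      exact le_max_left _ _
    · rw [eInt_coe (hint δ h.restrict_left n), eInt_coe (hint ω h.restrict_right n),
        EReal.coe_le_coe_iff]
      exact h.integral_le_of_sbhOn_real hVo hV (hu.sbhOn_lowerTrunc n)
        fun K hKV hK => lowerTrunc_bounded (hu.sbhOn_lowerTrunc n) hu.2.1 hKV hK
  have hpos : ∀ n, ∫⁻ x, erealPos (lowerTrunc u n x) ∂ω = ∫⁻ x, erealPos (u x) ∂ω := by
    intro n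
    refine lintegral_congr_ae ?_
    filter_upwards [hae ω h.restrict_right] with x hx
    have hmono : Monotone EReal.toENNReal := fun _ _ => EReal.toENNReal_le_toENNReal
    rw [coe_lowerTrunc (hu.2.1 x (hSV hx)), erealPos_eq_toENNReal, hmono.map_max,
      EReal.toENNReal_of_nonpos (x := ((-n : ℝ) : EReal)) (by
        rw [← EReal.coe_zero, EReal.coe_le_coe_iff]; simp), erealPos_eq_toENNReal]
    exact max_eq_left bot_le
  have hfin : ∫⁻ x, erealPos (u x) ∂ω ≠ ⊤ := by
    rw [← hpos 0]
    have := (hint ω h.restrict_right 0).lintegral_lt_top.ne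
    simpa [erealPos] using this
  have hneg : Tendsto (fun n => ∫⁻ x, erealPos (-(lowerTrunc u n x : EReal)) ∂ω) atTop
      (𝓝 (∫⁻ x, erealPos (-(u x)) ∂ω)) := by
    refine lintegral_tendsto_of_tendsto_of_monotone (fun n => ?_) ?_ ?_
    · have := (hint ω h.restrict_right n).1.aemeasurable
      exact EReal.continuous_toENNReal.measurable.comp_aemeasurable this.coe_real_ereal.neg
    · filter_upwards [hae ω h.restrict_right] with x hx m n hmn
      exact EReal.toENNReal_le_toENNReal
        (EReal.neg_le_neg_iff.2 (lowerTrunc_antitone (hu.2.1 x (hSV hx)) hmn))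
    · filter_upwards [hae ω h.restrict_right] with x hx
      exact (EReal.continuous_toENNReal.comp continuous_neg).continuousAt.tendsto.comp
        (tendsto_lowerTrunc (hu.2.1 x (hSV hx)))
  have hlim : Tendsto (fun n => eInt ω fun x => (lowerTrunc u n x : EReal)) atTop
      (𝓝 (eInt ω u)) := by
    simp only [eInt, hpos, sub_eq_add_neg]
    set P : EReal := ((∫⁻ x, erealPos (u x) ∂ω : ℝ≥0∞) : EReal) with hP
    set N : EReal := ((∫⁻ x, erealPos (-u x) ∂ω : ℝ≥0∞) : EReal)
    have hPt : P ≠ ⊤ := by simpa [hP] using hfin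
    have hPb : P ≠ ⊥ := by simp [hP]
    have hadd : ContinuousAt (fun p : EReal × EReal => p.1 + p.2) (P, -N) :=
      EReal.continuousAt_add (.inl hPt) (.inl hPb)
    have hN := (continuous_neg.comp continuous_coe_ennreal_ereal).continuousAt.tendsto.comp hneg
    exact hadd.tendsto.comp ((tendsto_const_nhds (x := P)).prodMk_nhds hN)
  exact ge_of_tendsto' hlim hle

end Balayage

lemma eInt_le_of_subsingleton {d : ℕ} [Subsingleton (Euc d)] {O : Set (Euc d)} (hOne : O.Nonempty)
    {δ ω : Measure (Euc d)} (hδ : MeasCompIn δ O) (hω : MeasCompIn ω O)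
    (hbal : ∀ u : Euc d → EReal, SbhOn u O → eInt δ u ≤ eInt ω u) {u : Euc d → EReal}
    {V : Set (Euc d)} (hV : infill O (msupp ω ∪ msupp δ) ⊆ V) (hu : SbhOn u V) :
    eInt δ u ≤ eInt ω u := by
  rcases V.eq_empty_or_nonempty with rfl | hne
  · have hS : msupp ω ∪ msupp δ = ∅ := subset_empty_iff.1 (subset_union_left.trans hV)
    have h0 : ∀ μ : Measure (Euc d), MeasCompIn μ O → msupp μ = ∅ → μ = 0 := fun μ hμ h => by
      have := hμ.2.2.1
      rwa [h, compl_empty, Measure.measure_univ_eq_zero] at this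
    rw [h0 δ hδ (union_empty_iff.1 hS).2, h0 ω hω (union_empty_iff.1 hS).1]
  · refine hbal u ?_
    rwa [Subsingleton.eq_univ_of_nonempty hOne, ← Subsingleton.eq_univ_of_nonempty hne]

/-- Let `ω` be an `sbh(O)`-balayage of `δ` (both finite positive Borel
measures with compact support in the open set `O ⊆ ℝ^d`), and let
`S_O := infill O (supp ω ∪ supp δ)`. Then `∫ u dδ ≤ ∫ u dω` for every function `u`
subharmonic on an open neighbourhood of `S_O`; in particular, for every open `O' ⊇ S_O`,
`ω` is an `sbh(O')`-balayage of `δ`. -/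
theorem stmt_15 {d : ℕ} (O : Set (Euc d)) (hO : IsOpen O) (hOne : O.Nonempty)
    (δ ω : Measure (Euc d)) (hδ : MeasCompIn δ O) (hω : MeasCompIn ω O)
    (hbal : ∀ u : Euc d → EReal, SbhOn u O → eInt δ u ≤ eInt ω u) :
    (∀ u : Euc d → EReal, ∀ V : Set (Euc d), IsOpen V →
        infill O (msupp ω ∪ msupp δ) ⊆ V → SbhOn u V → eInt δ u ≤ eInt ω u) ∧
    (∀ O' : Set (Euc d), IsOpen O' → infill O (msupp ω ∪ msupp δ) ⊆ O' →
        ∀ u : Euc d → EReal, SbhOn u O' → eInt δ u ≤ eInt ω u) := by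
  have key : ∀ u : Euc d → EReal, ∀ V : Set (Euc d), IsOpen V →
      infill O (msupp ω ∪ msupp δ) ⊆ V → SbhOn u V → eInt δ u ≤ eInt ω u := by
    intro u V hVo hV hu
    rcases eq_or_ne d 0 with rfl | hd
    · exact eInt_le_of_subsingleton hOne hδ hω hbal hV hu
    · have : NeZero d := ⟨hd⟩
      exact Balayage.eInt_le ⟨hO, hδ, hω, hbal⟩ hVo hV hu
  exact ⟨key, fun O' hO' hsub u hu => key u O' hO' hsub hu⟩
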